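/- Let Z be a compact metrizable space, let G be a countable sofic group with sofic approximation sequence Σ, and consider the left shift action of G on X = Z^G given by (sx)_t = x_{s^{-1}t}. Then mdim_Σ(X) ≤ mdim_{Σ,M}(X) ≤ dim Z. If furthermore Z contains a homeomorphic copy of [0,1]^n for every natural number n ≤ dim Z, then mdim_Σ(X) = mdim_{Σ,M}(X) = dim Z. -/

import Mathlib

open Filter Topology TopologicalSpace
open scoped ENat
open scoped Classical Pointwise

namespace SoficMD

/-- A sofic approximation sequence for a group `G`. -/
structure SoficApprox (G : Type*) [Group G] where
  d : ℕ → ℕ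
  σ : ∀ i, G → Equiv.Perm (Fin (d i))
  approx_mul : ∀ s t : G, Tendsto
    (fun i => ((Finset.univ.filter fun a : Fin (d i) => σ i s (σ i t a) = σ i (s * t) a).card : ℝ) / (d i : ℝ))
    atTop (𝓝 1)
  approx_sep : ∀ s t : G, s ≠ t → Tendsto
    (fun i => ((Finset.univ.filter fun a : Fin (d i) => σ i s a = σ i t a).card : ℝ) / (d i : ℝ))
    atTop (𝓝 0)
  d_tendsto : Tendsto d atTop atTop

/-- A continuous pseudometric on a topological space. -/
structure ContPseudoMetric (X : Type*) [TopologicalSpace X] where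
  d : X → X → ℝ
  continuous' : Continuous fun p : X × X => d p.1 p.2
  nonneg : ∀ x y, 0 ≤ d x y
  symm : ∀ x y, d x y = d y x
  refl : ∀ x, d x x = 0
  triangle : ∀ x y z, d x z ≤ d x y + d y z

/-- A continuous pseudometric on a compact Hausdorff space is a compatible metric iff it
separates points. -/
def ContPseudoMetric.IsCompatMetric {X : Type*} [TopologicalSpace X]
    (ρ : ContPseudoMetric X) : Prop :=
  ∀ x y : X, ρ.d x y = 0 → x = y

/-- A continuous pseudometric is dynamically generating if translates separate points. -/
def DynGenerating (G : Type*) {X : Type*} [Group G] [TopologicalSpace X] [MulAction G X]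
    (ρ : ContPseudoMetric X) : Prop :=
  ∀ x y : X, x ≠ y → ∃ s : G, 0 < ρ.d (s • x) (s • y)

/-- Equivariance of a map between two `G`-spaces. -/
def Equivariant (G : Type*) {A B : Type*} [SMul G A] [SMul G B] (f : A → B) : Prop :=
  ∀ (s : G) (a : A), f (s • a) = s • f a

/-- The normalized ℓ² pseudometric on maps `[d] → X`. -/
noncomputable def rho2 {X : Type*} [TopologicalSpace X] (ρ : ContPseudoMetric X) {d : ℕ}
    (φ ψ : Fin d → X) : ℝ :=
  Real.sqrt ((1 / (d : ℝ)) * ∑ a, (ρ.d (φ a) (ψ a)) ^ 2)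

/-- The ℓ^∞ pseudometric on maps `[d] → X`. -/
noncomputable def rhoInfty {X : Type*} [TopologicalSpace X] (ρ : ContPseudoMetric X) {d : ℕ}
    (φ ψ : Fin d → X) : ℝ :=
  ⨆ a : Fin d, ρ.d (φ a) (ψ a)

/-- The space of `(ρ, F, δ)`-approximately equivariant maps `[d] → X` relative to `σ`. -/
def MapSpace {G X : Type*} [Group G] [TopologicalSpace X] [MulAction G X]
    (ρ : ContPseudoMetric X) (F : Finset G) (δ : ℝ) {d : ℕ}
    (σ : G → Equiv.Perm (Fin d)) : Set (Fin d → X) :=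
  {φ | ∀ s ∈ F, rho2 ρ (fun a => φ (σ s a)) (fun a => s • φ a) ≤ δ}

/-- A finite open cover. -/
def IsFinOpenCover {Y : Type*} [TopologicalSpace Y] (𝒰 : Finset (Set Y)) : Prop :=
  (∀ U ∈ 𝒰, IsOpen U) ∧ (⋃ U ∈ 𝒰, U) = Set.univ

/-- `𝒱` refines `𝒰`. -/
def Refines {Y : Type*} (𝒱 𝒰 : Finset (Set Y)) : Prop :=
  ∀ V ∈ 𝒱, ∃ U ∈ 𝒰, V ⊆ U

/-- `ord` of a finite family of sets: the maximal multiplicity minus one. -/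
noncomputable def coverOrd {Y : Type*} (𝒰 : Finset (Set Y)) : EReal :=
  (⨆ y : Y, (((𝒰.filter fun U => y ∈ U).card : ℝ) : EReal)) - 1

/-- `D(𝒰)`: the infimum of `ord 𝒱` over finite open covers `𝒱` refining `𝒰`. -/
noncomputable def coverD {Y : Type*} [TopologicalSpace Y] (𝒰 : Finset (Set Y)) : EReal :=
  ⨅ 𝒱 ∈ {𝒱 : Finset (Set Y) | IsFinOpenCover 𝒱 ∧ Refines 𝒱 𝒰}, coverOrd 𝒱

/-- the product cover `𝒰^d` of `Y^[d]`. -/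
noncomputable def prodCover {Y : Type*} (𝒰 : Finset (Set Y)) (d : ℕ) :
    Finset (Set (Fin d → Y)) :=
  (Fintype.piFinset fun _ : Fin d => 𝒰).image fun U => {φ | ∀ a, φ a ∈ U a}

/-- restriction of a cover to a subset, viewed as a cover of the subtype. -/
noncomputable def restrictCover {Y : Type*} (𝒰 : Finset (Set Y)) (Z : Set Y) :
    Finset (Set Z) :=
  𝒰.image fun U => (Subtype.val ⁻¹' U : Set Z)

/-- `D(𝒰, ρ, F, δ, σ)`. -/
noncomputable def coverDMap {G X : Type*} [Group G] [TopologicalSpace X] [MulAction G X]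
    (𝒰 : Finset (Set X)) (ρ : ContPseudoMetric X) (F : Finset G) (δ : ℝ) {d : ℕ}
    (σ : G → Equiv.Perm (Fin d)) : EReal :=
  coverD (restrictCover (prodCover 𝒰 d) (MapSpace ρ F δ σ))

/-- `D_Σ(𝒰, ρ, F, δ)`. -/
noncomputable def DSigmaFdel {G X : Type*} [Group G] [TopologicalSpace X] [MulAction G X]
    (Sap : SoficApprox G) (𝒰 : Finset (Set X)) (ρ : ContPseudoMetric X)
    (F : Finset G) (δ : ℝ) : EReal :=
  limsup (fun i => coverDMap 𝒰 ρ F δ (Sap.σ i) * ((Sap.d i : ℝ)⁻¹ : EReal)) atTop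

/-- `D_Σ(𝒰, ρ, F)`. -/
noncomputable def DSigmaF {G X : Type*} [Group G] [TopologicalSpace X] [MulAction G X]
    (Sap : SoficApprox G) (𝒰 : Finset (Set X)) (ρ : ContPseudoMetric X)
    (F : Finset G) : EReal :=
  ⨅ δ : {δ : ℝ // 0 < δ}, DSigmaFdel Sap 𝒰 ρ F δ.1

/-- `D_Σ(𝒰, ρ)`. -/
noncomputable def DSigmaU {G X : Type*} [Group G] [TopologicalSpace X] [MulAction G X]
    (Sap : SoficApprox G) (𝒰 : Finset (Set X)) (ρ : ContPseudoMetric X) : EReal :=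
  ⨅ F : {F : Finset G // F.Nonempty}, DSigmaF Sap 𝒰 ρ F.1

/-- the sofic mean topological dimension `mdim_Σ(X, ρ)`. -/
noncomputable def mdimSigma {G X : Type*} [Group G] [TopologicalSpace X] [MulAction G X]
    (Sap : SoficApprox G) (ρ : ContPseudoMetric X) : EReal :=
  ⨆ 𝒰 ∈ {𝒰 : Finset (Set X) | IsFinOpenCover 𝒰}, DSigmaU Sap 𝒰 ρ

/-- `N_ε(Y, ρ)`: the maximal cardinality of `ε`-separated subsets. -/
noncomputable def sepNum {Y : Type*} (ρ : Y → Y → ℝ) (ε : ℝ) : ℕ∞ :=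
  ⨆ E ∈ {E : Set Y | ∀ x ∈ E, ∀ y ∈ E, x ≠ y → ε ≤ ρ x y}, E.encard

/-- The extended-real logarithm of an extended natural number. -/
noncomputable def elog (n : ℕ∞) : EReal :=
  if n = ⊤ then ⊤ else if n = 0 then ⊥ else ((Real.log n.toNat : ℝ) : EReal)

/-- `log N_ε(Map(ρ,F,δ,σ), ρ_∞)`. -/
noncomputable def hCnt {G X : Type*} [Group G] [TopologicalSpace X] [MulAction G X]
    (ρ : ContPseudoMetric X) (F : Finset G) (δ : ℝ) {d : ℕ}
    (σ : G → Equiv.Perm (Fin d)) (ε : ℝ) : EReal :=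
  elog (sepNum (fun φ ψ : MapSpace ρ F δ σ => rhoInfty ρ φ.1 ψ.1) ε)

/-- `h^ε_{Σ,∞}(ρ, F, δ)`. -/
noncomputable def hEpsFdel {G X : Type*} [Group G] [TopologicalSpace X] [MulAction G X]
    (Sap : SoficApprox G) (ρ : ContPseudoMetric X) (ε : ℝ) (F : Finset G) (δ : ℝ) : EReal :=
  limsup (fun i => hCnt ρ F δ (Sap.σ i) ε * ((Sap.d i : ℝ)⁻¹ : EReal)) atTop

/-- `h^ε_{Σ,∞}(ρ)`. -/
noncomputable def hEps {G X : Type*} [Group G] [TopologicalSpace X] [MulAction G X]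
    (Sap : SoficApprox G) (ρ : ContPseudoMetric X) (ε : ℝ) : EReal :=
  ⨅ F : {F : Finset G // F.Nonempty}, ⨅ δ : {δ : ℝ // 0 < δ}, hEpsFdel Sap ρ ε F.1 δ.1

/-- The sofic mean metric dimension `mdim_{Σ,M}(X, ρ)`. -/
noncomputable def mdimSigmaM {G X : Type*} [Group G] [TopologicalSpace X] [MulAction G X]
    (Sap : SoficApprox G) (ρ : ContPseudoMetric X) : EReal :=
  liminf (fun ε : ℝ => hEps Sap ρ ε * ((|Real.log ε|⁻¹ : ℝ) : EReal)) (𝓝[>] (0 : ℝ))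

/-- The sofic mean metric dimension `mdim_{Σ,M}(X)`. -/
noncomputable def mdimSigmaMFull {G : Type*} [Group G] (Sap : SoficApprox G)
    (X : Type*) [TopologicalSpace X] [MulAction G X] : EReal :=
  ⨅ ρ : {ρ : ContPseudoMetric X // ρ.IsCompatMetric}, mdimSigmaM Sap ρ.1

/-- Følner-type characterization of amenability of a discrete group. -/
def AmenableF (G : Type*) [Group G] : Prop :=
  ∀ (K : Finset G) (ε : ℝ), 0 < ε →
    ∃ F : Finset G, F.Nonempty ∧ (((K * F) \ F).card : ℝ) < ε * F.card

/-- The set of `(K, ε)`-invariant nonempty finite subsets of `G`. -/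
noncomputable def FolnerSets {G : Type*} [Group G] (K : Finset G) (ε : ℝ) :
    Set (Finset G) :=
  {F | F.Nonempty ∧ (((K * F) \ F).card : ℝ) < ε * F.card}

/-- The cover `𝒰^F = ⋁_{s ∈ F} s⁻¹ 𝒰`. -/
noncomputable def coverJoin {G X : Type*} [Group G] [TopologicalSpace X] [MulAction G X]
    (𝒰 : Finset (Set X)) (F : Finset G) : Finset (Set X) :=
  (F.pi fun _ => 𝒰).image fun f => ⋂ s, ⋂ (h : s ∈ F), (fun x : X => s • x) ⁻¹' f s h

/-- `mdim(𝒰)` as an inf-sup over more and more invariant sets. -/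
noncomputable def mdimCoverIS {G X : Type*} [Group G] [TopologicalSpace X] [MulAction G X]
    (𝒰 : Finset (Set X)) : EReal :=
  ⨅ K : Finset G, ⨅ ε : {ε : ℝ // 0 < ε},
    ⨆ F ∈ FolnerSets K ε.1, coverD (coverJoin 𝒰 F) * ((F.card : ℝ)⁻¹ : EReal)

/-- `mdim(𝒰)` as a sup-inf over more and more invariant sets. -/
noncomputable def mdimCoverSI {G X : Type*} [Group G] [TopologicalSpace X] [MulAction G X]
    (𝒰 : Finset (Set X)) : EReal :=
  ⨆ K : Finset G, ⨆ ε : {ε : ℝ // 0 < ε},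
    ⨅ F ∈ FolnerSets K ε.1, coverD (coverJoin 𝒰 F) * ((F.card : ℝ)⁻¹ : EReal)

/-- mean topological dimension, inf-sup form. -/
noncomputable def mdimIS (G X : Type*) [Group G] [TopologicalSpace X] [MulAction G X] :
    EReal :=
  ⨆ 𝒰 ∈ {𝒰 : Finset (Set X) | IsFinOpenCover 𝒰}, mdimCoverIS (G := G) 𝒰

/-- mean topological dimension, sup-inf form. -/
noncomputable def mdimSI (G X : Type*) [Group G] [TopologicalSpace X] [MulAction G X] :
    EReal :=
  ⨆ 𝒰 ∈ {𝒰 : Finset (Set X) | IsFinOpenCover 𝒰}, mdimCoverSI (G := G) 𝒰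

/-- the pseudometric `ρ_F(x,y) = max_{s ∈ F} ρ(sx, sy)`. -/
noncomputable def rhoF {G X : Type*} [Group G] [TopologicalSpace X] [MulAction G X]
    (ρ : ContPseudoMetric X) (F : Finset G) (x y : X) : ℝ :=
  ⨆ s : F, ρ.d ((s : G) • x) ((s : G) • y)

/-- diameter of a set w.r.t. a pseudometric given as a function. -/
noncomputable def diamP {Y : Type*} (ρ : Y → Y → ℝ) (U : Set Y) : ℝ :=
  ⨆ x : U, ⨆ y : U, ρ x y

/-- mesh of a finite cover w.r.t. a pseudometric given as a function. -/
noncomputable def meshP {Y : Type*} (ρ : Y → Y → ℝ) (𝒰 : Finset (Set Y)) : ℝ :=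
  ⨆ U : 𝒰, diamP ρ U.1

/-- minimal cardinality of a finite open cover of mesh `< ε`. -/
noncomputable def minCoverCard {Y : Type*} [TopologicalSpace Y] (ρ : Y → Y → ℝ) (ε : ℝ) : ℕ :=
  sInf {n : ℕ | ∃ 𝒰 : Finset (Set Y), IsFinOpenCover 𝒰 ∧ meshP ρ 𝒰 < ε ∧ 𝒰.card = n}

/-- `S(X, ε, ρ)` in inf-sup form. -/
noncomputable def SamenIS {G X : Type*} [Group G] [TopologicalSpace X] [MulAction G X]
    (ρ : ContPseudoMetric X) (ε : ℝ) : EReal :=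
  ⨅ K : Finset G, ⨅ δ : {δ : ℝ // 0 < δ},
    ⨆ F ∈ FolnerSets K δ.1,
      ((Real.log (minCoverCard (rhoF ρ F) ε) / F.card : ℝ) : EReal)

/-- `S(X, ε, ρ)` in sup-inf form. -/
noncomputable def SamenSI {G X : Type*} [Group G] [TopologicalSpace X] [MulAction G X]
    (ρ : ContPseudoMetric X) (ε : ℝ) : EReal :=
  ⨆ K : Finset G, ⨆ δ : {δ : ℝ // 0 < δ},
    ⨅ F ∈ FolnerSets K δ.1,
      ((Real.log (minCoverCard (rhoF ρ F) ε) / F.card : ℝ) : EReal)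

/-- mean metric dimension `mdim_M(X, ρ)`, inf-sup form. -/
noncomputable def mdimMIS {G X : Type*} [Group G] [TopologicalSpace X] [MulAction G X]
    (ρ : ContPseudoMetric X) : EReal :=
  liminf (fun ε : ℝ => SamenIS (G := G) ρ ε * ((|Real.log ε|⁻¹ : ℝ) : EReal)) (𝓝[>] (0 : ℝ))

/-- mean metric dimension `mdim_M(X, ρ)`, sup-inf form. -/
noncomputable def mdimMSI {G X : Type*} [Group G] [TopologicalSpace X] [MulAction G X]
    (ρ : ContPseudoMetric X) : EReal :=
  liminf (fun ε : ℝ => SamenSI (G := G) ρ ε * ((|Real.log ε|⁻¹ : ℝ) : EReal)) (𝓝[>] (0 : ℝ))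

/-- The covering dimension of a topological space, as an extended natural number. -/
noncomputable def covDim (Y : Type*) [TopologicalSpace Y] : ℕ∞ :=
  sInf {n : ℕ∞ | ∀ 𝒰 : Finset (Set Y), IsFinOpenCover 𝒰 →
    ∃ 𝒱 : Finset (Set Y), IsFinOpenCover 𝒱 ∧ Refines 𝒱 𝒰 ∧
      ∀ y : Y, (((𝒱.filter fun V => y ∈ V).card : ℕ∞)) ≤ n + 1}

/-- conversion of extended naturals into extended reals. -/
noncomputable def enatToEReal (n : ℕ∞) : EReal :=
  if n = ⊤ then ⊤ else ((n.toNat : ℝ) : EReal)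

/-- The action of `G` on a `G`-invariant subset. -/
def invariantSubMulAction {G X : Type*} [Group G] [MulAction G X] (Y : Set X)
    (h : ∀ (s : G), ∀ x ∈ Y, s • x ∈ Y) : MulAction G Y where
  smul s y := ⟨s • (y : X), h s y y.2⟩
  one_smul y := Subtype.ext (one_smul G (y : X))
  mul_smul s t y := Subtype.ext (mul_smul s t (y : X))

end SoficMD


open Filter Topology TopologicalSpace
open scoped ENat
open scoped Classical Pointwise

namespace SoficMD

section Shift

variable (G : Type*) [Group G] (Z : Type*)

/-- The left shift action of `G` on `Z^G`: `(s • x)_t = x_{s⁻¹ t}`. -/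
instance shiftSMul : SMul G (G → Z) :=
  ⟨fun s x t => x (s⁻¹ * t)⟩

instance shiftMulAction : MulAction G (G → Z) where
  one_smul x := funext fun t => by
    show x (1⁻¹ * t) = x t
    rw [inv_one, one_mul]
  mul_smul s t x := funext fun u => by
    show x ((s * t)⁻¹ * u) = x (t⁻¹ * (s⁻¹ * u))
    rw [mul_inv_rev, mul_assoc]

instance shiftContinuousConstSMul [TopologicalSpace Z] : ContinuousConstSMul G (G → Z) :=
  ⟨fun s => continuous_pi fun t => continuous_apply (s⁻¹ * t)⟩

end Shift

section Kuhn

/-- The vertices of the Kuhn simplex of the unit cube at `p` whose directions are ranked by `r`,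
listed from `p + (1, …, 1)` down to `p`. -/
def kuhnVertex {m : ℕ} (p : Fin m → ℕ) (r : Equiv.Perm (Fin m)) (k : ℕ) : Fin m → ℕ :=
  fun j => p j + if k ≤ (r j : ℕ) then 1 else 0

/-- The parity of the number of bijections matching the labels `ℓ` with `{s, …, s + n - 1}`. -/
def labelDet {n : ℕ} (s : ℕ) (ℓ : Fin n → ℕ) : ZMod 2 :=
  Matrix.det fun a k : Fin n => if ℓ k = a + s then 1 else 0

lemma labelDet_eq_zero {n s : ℕ} {ℓ : Fin n → ℕ} (a : Fin n) (h : ∀ k, ℓ k ≠ a + s) :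
    labelDet s ℓ = 0 :=
  Matrix.det_eq_zero_of_row_eq_zero a fun k => if_neg (h k)

lemma labelDet_zero_eq_sum {m : ℕ} (ℓ : Fin (m + 1) → ℕ) (hℓ : ∀ k, ℓ k ≤ m) :
    labelDet 0 ℓ = ∑ i : Fin (m + 1), labelDet 1 fun k => ℓ (i.succAbove k) := by
  set M : Matrix (Fin (m + 1)) (Fin (m + 1)) (ZMod 2) :=
    fun a k => if ℓ k = a + 0 then 1 else 0 with hM
  have hdet : labelDet 0 ℓ = (M.updateRow 0 fun _ => 1).det := by
    have h := Matrix.det_updateRow_sum M 0 fun _ => 1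
    rw [one_smul] at h
    rw [labelDet, ← h]
    congr 2
    funext k
    simp only [one_smul, Finset.sum_apply, hM, add_zero]
    rw [Finset.sum_eq_single (⟨ℓ k, Nat.lt_succ_of_le (hℓ k)⟩ : Fin (m + 1))]
    · simp
    · intro b _ hb
      exact if_neg fun h => hb (Fin.ext h.symm)
    · simp
  rw [hdet, Matrix.det_succ_row_zero]
  refine Finset.sum_congr rfl fun i _ => ?_
  have hsign : ((-1 : ZMod 2)) ^ (i : ℕ) = 1 := by
    rw [show (-1 : ZMod 2) = 1 from rfl, one_pow]
  rw [hsign, one_mul, Matrix.updateRow_self, one_mul, labelDet]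
  congr 1

lemma sum_add_shift {m N : ℕ} (g : (Fin (m + 1) → ℕ) → ZMod 2) (j : Fin (m + 1)) :
    ∑ p ∈ Fintype.piFinset (fun _ : Fin (m + 1) => Finset.range N),
        (g p + g (fun i => p i + if i = j then 1 else 0)) =
      ∑ p ∈ Fintype.piFinset (fun _ : Fin m => Finset.range N),
        (g (j.insertNth 0 p) + g (j.insertNth N p)) := by
  have hsum : ∀ f : (Fin (m + 1) → ℕ) → ZMod 2,
      ∑ p ∈ Fintype.piFinset (fun _ : Fin (m + 1) => Finset.range N), f p =
        ∑ p ∈ Fintype.piFinset (fun _ : Fin m => Finset.range N),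
          ∑ x ∈ Finset.range N, f (j.insertNth x p) := by
    intro f
    rw [← Finset.sum_product']
    refine Finset.sum_nbij' (fun p => (fun i => p (j.succAbove i), p j))
      (fun y => j.insertNth y.2 y.1) ?_ ?_ ?_ ?_ ?_
    · intro p hp
      simp only [Fintype.mem_piFinset, Finset.mem_product] at hp ⊢
      exact ⟨fun i => hp _, hp _⟩
    · intro y hy
      simp only [Fintype.mem_piFinset, Finset.mem_product] at hy ⊢
      rw [Fin.forall_iff_succAbove j]
      simpa using ⟨Finset.mem_range.1 hy.2, fun i => Finset.mem_range.1 (hy.1 i)⟩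
    · intro p _
      exact Fin.insertNth_self_removeNth j p
    · intro y _
      simp
    · intro p _
      exact congrArg f (Fin.insertNth_self_removeNth j p).symm
  rw [hsum]
  refine Finset.sum_congr rfl fun p hp => ?_
  clear hp
  have hshift : ∀ x : ℕ, (fun i => (j.insertNth x p : Fin (m + 1) → ℕ) i +
      if i = j then 1 else 0) = (j.insertNth (x + 1) p : Fin (m + 1) → ℕ) := by
    intro x
    funext i
    refine Fin.succAboveCases j ?_ (fun i => ?_) i
    · simp
    · simp
  simp only [hshift]
  clear hsum
  induction N with
  | zero => simp [CharTwo.add_self_eq_zero]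
  | succ N ih =>
    rw [Finset.sum_range_succ, ih]
    rw [add_assoc, ← add_assoc (g (j.insertNth N p)), CharTwo.add_self_eq_zero, zero_add]

lemma kuhnVertex_swap {m : ℕ} (p : Fin m → ℕ) (r : Equiv.Perm (Fin m)) (a b : Fin m)
    (hab : (b : ℕ) = a + 1) {k : ℕ} (hk : k ≠ b) :
    kuhnVertex p (Equiv.swap a b * r) k = kuhnVertex p r k := by
  funext j
  have h : k ≤ ((Equiv.swap a b * r) j : ℕ) ↔ k ≤ (r j : ℕ) := by
    rw [Equiv.Perm.mul_apply, Equiv.swap_apply_def]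
    split_ifs with h1 h2
    · rw [h1]; omega
    · rw [h2]; omega
    · rfl
  simp only [kuhnVertex, h]

lemma kuhnVertex_rotate {m : ℕ} (p : Fin (m + 1) → ℕ) (r : Equiv.Perm (Fin (m + 1))) {k : ℕ}
    (hk : k ≤ m) :
    kuhnVertex (fun i => p i + if i = (finRotate (m + 1) * r)⁻¹ 0 then 1 else 0)
      (finRotate (m + 1) * r) (k + 1) = kuhnVertex p r k := by
  funext j
  have h0 : (j = (finRotate (m + 1) * r)⁻¹ 0) ↔ r j = Fin.last m := by
    rw [Equiv.Perm.eq_inv_iff_eq, Equiv.Perm.mul_apply, ← finRotate_last,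
      (finRotate (m + 1)).injective.eq_iff]
  by_cases h : r j = Fin.last m
  · simp only [kuhnVertex, h0, Equiv.Perm.mul_apply, h]
    simp [hk]
  · have h2 : ((finRotate (m + 1) * r) j : ℕ) = r j + 1 := coe_finRotate_of_ne_last h
    simp only [kuhnVertex, h0, h, h2, if_false, add_zero, add_le_add_iff_right]

lemma kuhnVertex_cons {m : ℕ} (N : ℕ) (p : Fin m → ℕ) (e : Equiv.Perm (Fin m)) (k : ℕ) :
    kuhnVertex (Fin.cons N p : Fin (m + 1) → ℕ) (Equiv.Perm.decomposeFin.symm (0, e)) (k + 1) =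
      (Fin.cons N (kuhnVertex p e k) : Fin (m + 1) → ℕ) := by
  funext j
  refine Fin.cases ?_ (fun j => ?_) j
  · simp [kuhnVertex]
  · simp [kuhnVertex, Equiv.Perm.decomposeFin_symm_apply_succ]

/-- Kuhn's cubical form of Sperner's lemma, with parity. -/
theorem sum_labelDet_eq_one {m : ℕ} (N : ℕ) (c : (Fin m → ℕ) → ℕ)
    (hc : ∀ p, c p ≤ m) (h0 : ∀ p (j : Fin m), p j = 0 → c p ≠ j + 1)
    (h1 : ∀ p (j : Fin m), p j = N → (j : ℕ) + 1 ≤ c p) :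
    ∑ p ∈ Fintype.piFinset (fun _ : Fin m => Finset.range N), ∑ r : Equiv.Perm (Fin m),
      labelDet 0 (fun k : Fin (m + 1) => c (kuhnVertex p r k)) = 1 := by
  induction m with
  | zero =>
    have hc0 : ∀ p, c p = 0 := fun p => Nat.le_zero.1 (hc p)
    have hdet : (Matrix.det fun _ _ : Fin (0 + 1) => (1 : ZMod 2)) = 1 := by decide
    simpa [labelDet, hc0] using hdet
  | succ m ih =>
    set A : (Fin (m + 1) → ℕ) → Equiv.Perm (Fin (m + 1)) → ZMod 2 := fun p r =>
      labelDet 1 fun k : Fin (m + 1) => c (kuhnVertex p r (k + 1)) with hA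
    have hfaces : ∀ p, ∑ r : Equiv.Perm (Fin (m + 1)),
        labelDet 0 (fun k : Fin (m + 1 + 1) => c (kuhnVertex p r k)) =
        ∑ r : Equiv.Perm (Fin (m + 1)),
          (A p r + A (fun i => p i + if i = r⁻¹ 0 then 1 else 0) r) := by
      intro p
      simp_rw [labelDet_zero_eq_sum _ fun k => hc _]
      rw [Finset.sum_comm, Fin.sum_univ_succ, Fin.sum_univ_castSucc, Finset.sum_add_distrib]
      have hmid : ∀ i : Fin m, ∑ r : Equiv.Perm (Fin (m + 1)),
          labelDet 1 (fun k => c (kuhnVertex p r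
            ((Fin.succ i.castSucc : Fin (m + 1 + 1)).succAbove k : Fin (m + 1 + 1)))) = 0 := by
        intro i
        have hab : ((i.succ : Fin (m + 1)) : ℕ) = (i.castSucc : Fin (m + 1)) + 1 := by simp
        refine Finset.sum_involution
          (fun r _ => Equiv.swap i.castSucc i.succ * r) ?_ ?_ ?_ ?_
        · intro r _
          have : ∀ k : Fin (m + 1), kuhnVertex p (Equiv.swap i.castSucc i.succ * r)
              ((Fin.succ i.castSucc : Fin (m + 1 + 1)).succAbove k : Fin (m + 1 + 1)) =
              kuhnVertex p r
              ((Fin.succ i.castSucc : Fin (m + 1 + 1)).succAbove k : Fin (m + 1 + 1)) := by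
            intro k
            refine kuhnVertex_swap p r _ _ hab fun h => ?_
            refine Fin.succAbove_ne (Fin.succ i.castSucc : Fin (m + 1 + 1)) k (Fin.ext ?_)
            rw [h]; simp
          simp_rw [this]
          exact CharTwo.add_self_eq_zero _
        · intro r _ _ h
          have h' : Equiv.swap i.castSucc i.succ = 1 := mul_eq_right.1 h
          exact (Fin.castSucc_lt_succ (i := i)).ne (Equiv.swap_eq_one_iff.1 h')
        · intro r _; exact Finset.mem_univ _
        · intro r _
          rw [← mul_assoc, Equiv.swap_mul_self, one_mul]
      rw [Finset.sum_congr rfl fun i _ => hmid i, Finset.sum_const_zero, zero_add]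
      congr 1
      rw [← Equiv.sum_comp (Equiv.mulLeft (finRotate (m + 1)))
        fun r => A (fun i => p i + if i = r⁻¹ 0 then 1 else 0) r]
      refine Finset.sum_congr rfl fun r _ => ?_
      refine congrArg (labelDet 1) (funext fun k => ?_)
      have hk : ((Fin.last m).succ.succAbove k : ℕ) = k := by simp
      rw [hk]
      exact (congrArg c (kuhnVertex_rotate p r (Nat.le_of_lt_succ k.2))).symm
    have hzero : ∀ p r, A ((r⁻¹ (0 : Fin (m + 1))).insertNth 0 p) r = 0 := by
      intro p r
      refine labelDet_eq_zero (r⁻¹ 0) fun k => h0 _ _ ?_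
      simp [kuhnVertex]
    have htop : ∀ p r, r⁻¹ (0 : Fin (m + 1)) ≠ 0 →
        A ((r⁻¹ (0 : Fin (m + 1))).insertNth N p) r = 0 := by
      intro p r hr
      refine labelDet_eq_zero 0 fun k h => ?_
      have h2 := h1 (kuhnVertex ((r⁻¹ (0 : Fin (m + 1))).insertNth N p) r (k + 1)) (r⁻¹ 0)
        (by simp [kuhnVertex])
      rw [h] at h2
      have : ((r⁻¹ 0 : Fin (m + 1)) : ℕ) ≠ 0 := fun h => hr (Fin.ext h)
      simp only [Fin.val_zero, zero_add] at h2
      omega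
    calc _ = ∑ p ∈ Fintype.piFinset (fun _ : Fin (m + 1) => Finset.range N),
          ∑ r : Equiv.Perm (Fin (m + 1)),
          (A p r + A (fun i => p i + if i = r⁻¹ 0 then 1 else 0) r) :=
          Finset.sum_congr rfl fun p _ => hfaces p
      _ = ∑ r : Equiv.Perm (Fin (m + 1)),
          ∑ p ∈ Fintype.piFinset (fun _ : Fin m => Finset.range N),
            A ((r⁻¹ (0 : Fin (m + 1))).insertNth N p) r := by
          rw [Finset.sum_comm]
          refine Finset.sum_congr rfl fun r _ => ?_
          rw [sum_add_shift (fun p => A p r)]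
          refine Finset.sum_congr rfl fun p _ => ?_
          rw [hzero, zero_add]
      _ = ∑ e : Equiv.Perm (Fin m),
          ∑ p ∈ Fintype.piFinset (fun _ : Fin m => Finset.range N),
            A (Fin.cons N p) (Equiv.Perm.decomposeFin.symm (0, e)) := by
          rw [← Equiv.sum_comp Equiv.Perm.decomposeFin.symm, Fintype.sum_prod_type,
            Finset.sum_eq_single 0]
          · refine Finset.sum_congr rfl fun e _ => Finset.sum_congr rfl fun p _ => ?_
            have : (Equiv.Perm.decomposeFin.symm ((0 : Fin (m + 1)), e))⁻¹ 0 = 0 := by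
              rw [Equiv.Perm.inv_eq_iff_eq]; simp
            rw [this, Fin.insertNth_zero']
          · intro x _ hx
            refine Finset.sum_eq_zero fun e _ => Finset.sum_eq_zero fun p _ => ?_
            refine htop _ _ fun h => hx ?_
            rw [Equiv.Perm.inv_eq_iff_eq] at h
            simpa using h.symm
          · simp
      _ = 1 := by
          rw [Finset.sum_comm]
          rw [← ih (fun p => c (Fin.cons N p) - 1) ?_ ?_ ?_]
          · refine Finset.sum_congr rfl fun p _ => Finset.sum_congr rfl fun e _ => ?_
            simp only [hA, kuhnVertex_cons, labelDet]
            congr 1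
            funext a k
            have := h1 (Fin.cons N (kuhnVertex p e k)) 0 (by simp)
            exact if_congr (by simp at this; omega) rfl rfl
          · intro p
            have := hc (Fin.cons N p)
            omega
          · intro p j hj h
            have := h0 (Fin.cons N p) j.succ (by simpa using hj)
            simp at this
            omega
          · intro p j hj
            have := h1 (Fin.cons N p) j.succ (by simpa using hj)
            simp at this
            omega

/-- The Lebesgue covering theorem: a finite open cover of a cube none of whose members meets two
opposite faces has a point of multiplicity greater than the dimension. -/
theorem exists_card_filter_mem_of_cube {ι : Type*} [Fintype ι]
    (𝒱 : Finset (Set (ι → Set.Icc (0 : ℝ) 1))) (h𝒱 : IsFinOpenCover 𝒱)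
    (hface : ∀ V ∈ 𝒱, ∀ j, ∀ x ∈ V, ∀ y ∈ V, x j = 0 → y j ≠ 1) :
    ∃ y, Fintype.card ι + 1 ≤ (𝒱.filter fun V => y ∈ V).card := by
  set m := Fintype.card ι
  let e : ι ≃ Fin m := Fintype.equivFin ι
  obtain ⟨δ, hδ, hball⟩ := lebesgue_number_lemma_of_metric
    (isCompact_univ (X := ι → Set.Icc (0 : ℝ) 1)) (c := fun V : 𝒱 => V.1)
    (fun V => h𝒱.1 V V.2) (by
      intro x _
      have hx : x ∈ ⋃ U ∈ 𝒱, U := h𝒱.2 ▸ Set.mem_univ x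
      simpa using hx)
  obtain ⟨N', hN'⟩ := exists_nat_one_div_lt hδ
  obtain ⟨N, hN⟩ : ∃ N : ℕ, N = N' + 1 := ⟨_, rfl⟩
  have hNpos : (0 : ℝ) < N := by rw [hN]; positivity
  have hNδ : 1 / (N : ℝ) < δ := by rw [hN]; exact_mod_cast hN'
  let pt : (Fin m → ℕ) → ι → Set.Icc (0 : ℝ) 1 := fun p i =>
    Set.projIcc 0 1 zero_le_one ((p (e i) : ℝ) / N)
  choose W hW using fun p => hball (pt p) (Set.mem_univ _)
  have hmemW : ∀ p, pt p ∈ (W p).1 := fun p => hW p (Metric.mem_ball_self hδ)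
  let S : (Fin m → ℕ) → Finset (Fin m) := fun p =>
    Finset.univ.filter fun j => ∀ x ∈ (W p).1, x (e.symm j) ≠ 0
  let c : (Fin m → ℕ) → ℕ := fun p => (S p).sup fun j => (j : ℕ) + 1
  have hsum := sum_labelDet_eq_one N c
    (fun p => Finset.sup_le fun j _ => j.2)
    (by
      intro p j hj hcp
      have hne : (S p).Nonempty := by
        rw [Finset.nonempty_iff_ne_empty]
        intro h
        simp [c, h] at hcp
      obtain ⟨i, hi, hi'⟩ := Finset.exists_mem_eq_sup (S p) hne fun j => (j : ℕ) + 1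
      have hij : i = j := by
        apply Fin.ext
        have : (i : ℕ) + 1 = j + 1 := hi'.symm.trans hcp
        omega
      subst hij
      refine (Finset.mem_filter.1 hi).2 (pt p) (hmemW p) ?_
      simp [pt, hj])
    (by
      intro p j hj
      refine Finset.le_sup (f := fun j : Fin m => (j : ℕ) + 1)
        (Finset.mem_filter.2 ⟨Finset.mem_univ j, fun x hx h0 => ?_⟩)
      refine hface _ (W p).2 (e.symm j) x hx (pt p) (hmemW p) h0 ?_
      simp [pt, hj, div_self hNpos.ne'])
  obtain ⟨p, -, hp⟩ := Finset.exists_ne_zero_of_sum_ne_zero (hsum.trans_ne one_ne_zero)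
  obtain ⟨r, -, hr⟩ := Finset.exists_ne_zero_of_sum_ne_zero hp
  have hex : ∀ a : Fin (m + 1), ∃ k : Fin (m + 1), c (kuhnVertex p r k) = a := by
    intro a
    by_contra! h
    exact hr (labelDet_eq_zero a (by simpa using h))
  choose k hk using hex
  refine ⟨pt p, ?_⟩
  have hcard := Finset.card_le_card_of_injOn (s := (Finset.univ : Finset (Fin (m + 1))))
    (t := 𝒱.filter fun V => pt p ∈ V) (fun a => (W (kuhnVertex p r (k a))).1)
    (by
      intro a _
      refine Finset.mem_coe.2 (Finset.mem_filter.2 ⟨(W _).2, hW _ ?_⟩)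
      rw [Metric.mem_ball]
      refine lt_of_le_of_lt ((dist_pi_le_iff (by positivity)).2 fun i => ?_) hNδ
      have h1 : dist (pt p i) (pt (kuhnVertex p r (k a)) i) ≤
          dist ((p (e i) : ℝ) / N) ((kuhnVertex p r (k a) (e i) : ℝ) / N) := by
        simpa using (LipschitzWith.projIcc (zero_le_one (α := ℝ))).dist_le_mul
          ((p (e i) : ℝ) / N) ((kuhnVertex p r (k a) (e i) : ℝ) / N)
      refine h1.trans ?_
      rw [Real.dist_eq, ← sub_div, abs_div, abs_of_pos hNpos]
      gcongr
      simp only [kuhnVertex]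
      split_ifs <;> simp)
    (by
      intro a _ b _ hab
      have hab' : W (kuhnVertex p r (k a)) = W (kuhnVertex p r (k b)) := Subtype.ext hab
      have : c (kuhnVertex p r (k a)) = c (kuhnVertex p r (k b)) := by
        simp only [c, S, hab']
      rw [hk, hk] at this
      exact Fin.ext this)
  simpa using hcard

end Kuhn

lemma ContPseudoMetric.exists_bound {X : Type*} [TopologicalSpace X] [CompactSpace X]
    (ρ : ContPseudoMetric X) : ∃ M : ℝ, 0 < M ∧ ∀ x y, ρ.d x y ≤ M := by
  obtain ⟨M, hM⟩ := (isCompact_range ρ.continuous').bddAbove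
  exact ⟨max M 1, by positivity, fun x y => (hM ⟨(x, y), rfl⟩).trans (le_max_left _ _)⟩

lemma ContPseudoMetric.exists_finset_forall_le {ι Z : Type*} [TopologicalSpace Z] [CompactSpace Z]
    [T2Space Z] (ρ : ContPseudoMetric (ι → Z)) {η : ℝ} (hη : 0 < η) :
    ∃ J : Finset ι, ∀ x y : ι → Z, (∀ t ∈ J, x t = y t) → ρ.d x y ≤ η := by
  have hK : IsCompact {p : (ι → Z) × (ι → Z) | η ≤ ρ.d p.1 p.2} :=
    (isClosed_le continuous_const ρ.continuous').isCompact
  obtain ⟨J, hJ⟩ := hK.elim_finite_subcover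
    (fun t : ι => {p : (ι → Z) × (ι → Z) | p.1 t ≠ p.2 t})
    (fun t => isOpen_ne_fun (by fun_prop) (by fun_prop)) (by
      rintro ⟨x, y⟩ h
      simp only [Set.mem_iUnion, Set.mem_ofPred_eq] at h ⊢
      by_contra! hxy
      obtain rfl : x = y := funext hxy
      rw [ρ.refl] at h
      exact absurd h hη.not_ge)
  refine ⟨J, fun x y hxy => ?_⟩
  by_contra! h
  obtain ⟨t, ht, hne⟩ := Set.mem_iUnion₂.1 (hJ (show (x, y) ∈ _ from h.le))
  exact hne (hxy t ht)

lemma SoficApprox.eventually_pos {G : Type*} [Group G] (Sap : SoficApprox G) :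
    ∀ᶠ i in atTop, 0 < Sap.d i := Sap.d_tendsto.eventually_gt_atTop 0

/-- Every configuration over a good enough sofic model induces an approximately equivariant map
into the shift. -/
lemma eventually_forall_mem_mapSpace {G : Type*} [Group G] (Sap : SoficApprox G) {Z : Type*}
    [TopologicalSpace Z] [CompactSpace Z] [T2Space Z] (ρ : ContPseudoMetric (G → Z))
    (F : Finset G) {δ : ℝ} (hδ : 0 < δ) :
    ∀ᶠ i in atTop, ∀ z : Fin (Sap.d i) → Z,
      (fun a t => z (Sap.σ i t⁻¹ a)) ∈ MapSpace ρ F δ (Sap.σ i) := by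
  obtain ⟨M, hM0, hM⟩ := ρ.exists_bound
  obtain ⟨J, hJ⟩ := ρ.exists_finset_forall_le (half_pos hδ)
  have hlim : ∀ s ∈ F, ∀ᶠ i in atTop, (δ / 2) ^ 2 + M ^ 2 * ∑ t ∈ J,
      (1 - ((Finset.univ.filter fun a : Fin (Sap.d i) =>
        Sap.σ i t⁻¹ (Sap.σ i s a) = Sap.σ i (t⁻¹ * s) a).card : ℝ) / (Sap.d i : ℝ)) < δ ^ 2 := by
    intro s _
    have h := ((tendsto_finsetSum J fun t _ =>
      (Sap.approx_mul t⁻¹ s).const_sub 1).const_mul (M ^ 2)).const_add ((δ / 2) ^ 2)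
    refine h.eventually_lt_const ?_
    simp only [sub_self, Finset.sum_const_zero, mul_zero, add_zero]
    nlinarith
  filter_upwards [(Filter.eventually_all_finset F).2 hlim, Sap.eventually_pos] with i hi hd z s hs
  have hd' : (0 : ℝ) < Sap.d i := by exact_mod_cast hd
  refine Real.sqrt_le_iff.2 ⟨hδ.le, le_trans ?_ (hi s hs).le⟩
  have hpt : ∀ a : Fin (Sap.d i),
      (ρ.d (fun t => z (Sap.σ i t⁻¹ (Sap.σ i s a))) (s • fun t => z (Sap.σ i t⁻¹ a))) ^ 2 ≤
      (δ / 2) ^ 2 + ∑ t ∈ J, M ^ 2 *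
        (1 - if Sap.σ i t⁻¹ (Sap.σ i s a) = Sap.σ i (t⁻¹ * s) a then 1 else 0) := by
    intro a
    have hnn : ∀ t ∈ J, 0 ≤ M ^ 2 *
        (1 - if Sap.σ i t⁻¹ (Sap.σ i s a) = Sap.σ i (t⁻¹ * s) a then (1 : ℝ) else 0) := by
      intro t _
      split_ifs <;> simp [sq_nonneg]
    by_cases h : ∀ t ∈ J, Sap.σ i t⁻¹ (Sap.σ i s a) = Sap.σ i (t⁻¹ * s) a
    · refine le_add_of_le_of_nonneg (pow_le_pow_left₀ (ρ.nonneg _ _) (hJ _ _ fun t ht => ?_) 2)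
        (Finset.sum_nonneg hnn)
      change z _ = z (Sap.σ i (s⁻¹ * t)⁻¹ a)
      rw [h t ht, mul_inv_rev, inv_inv]
    · push Not at h
      obtain ⟨t, ht, hne⟩ := h
      refine le_add_of_nonneg_of_le (sq_nonneg _)
        (le_trans ?_ (Finset.single_le_sum hnn ht))
      rw [if_neg hne, sub_zero, mul_one]
      exact pow_le_pow_left₀ (ρ.nonneg _ _) (hM _ _) 2
  calc _ ≤ 1 / (Sap.d i : ℝ) * ∑ a : Fin (Sap.d i), ((δ / 2) ^ 2 + ∑ t ∈ J, M ^ 2 *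
        (1 - if Sap.σ i t⁻¹ (Sap.σ i s a) = Sap.σ i (t⁻¹ * s) a then 1 else 0)) := by
        gcongr with a
        exact hpt a
    _ = _ := by
        rw [Finset.sum_add_distrib, Finset.sum_comm]
        simp_rw [← Finset.mul_sum, Finset.sum_sub_distrib, Finset.sum_boole]
        simp only [Finset.sum_const, Finset.card_univ, Fintype.card_fin, nsmul_eq_mul, mul_one]
        rw [← Finset.sum_div]
        field_simp

lemma coverOrd_ge_of_card {Y : Type*} {𝒱 : Finset (Set Y)} {y : Y} {k : ℕ}
    (h : k + 1 ≤ (𝒱.filter fun V => y ∈ V).card) : ((k : ℝ) : EReal) ≤ coverOrd 𝒱 := by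
  have h1 : (((k + 1 : ℕ) : ℝ) : EReal) - 1 ≤ coverOrd 𝒱 := by
    refine EReal.sub_le_sub (le_trans ?_ (le_iSup _ y)) le_rfl
    exact_mod_cast h
  refine le_trans (le_of_eq ?_) h1
  rw [← EReal.coe_one, ← EReal.coe_sub]
  simp

/-- The open cover of `G → Z` detecting opposite faces of a cube embedded in `Z`. -/
noncomputable def faceCover (G : Type*) [Group G] {Z : Type*} {n : ℕ}
    (f : (Fin n → Set.Icc (0 : ℝ) 1) → Z) : Finset (Set (G → Z)) :=
  Finset.univ.image fun T : Finset (Fin n) =>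
    {x | ∀ j, ∀ y, x 1 = f y → (j ∈ T → y j ≠ 0) ∧ (j ∉ T → y j ≠ 1)}

lemma isFinOpenCover_faceCover (G : Type*) [Group G] {Z : Type*} [TopologicalSpace Z] [T2Space Z]
    {n : ℕ} {f : (Fin n → Set.Icc (0 : ℝ) 1) → Z} (hf : Continuous f)
    (hinj : Function.Injective f) : IsFinOpenCover (faceCover G f) := by
  refine ⟨?_, ?_⟩
  · simp only [faceCover, Finset.mem_image, Finset.mem_univ, true_and, forall_exists_index]
    rintro _ T rfl
    simp only [Set.ofPred_forall]
    refine isOpen_iInter_of_finite fun j => ?_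
    have hcl : ∀ c : Set.Icc (0 : ℝ) 1, IsClosed (f '' {y | y j = c}) := fun c =>
      (((isClosed_eq (continuous_apply j) continuous_const).isCompact).image hf).isClosed
    by_cases hj : j ∈ T
    · convert (hcl 0).isOpen_compl.preimage
        (continuous_apply (A := fun _ : G => Z) (1 : G)) using 1
      ext x
      simp [hj]
      grind
    · convert (hcl 1).isOpen_compl.preimage
        (continuous_apply (A := fun _ : G => Z) (1 : G)) using 1
      ext x
      simp [hj]
      grind
  · refine Set.eq_univ_of_forall fun x => ?_
    rw [Set.mem_iUnion₂]
    refine ⟨_, Finset.mem_image_of_mem _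
      (Finset.mem_univ (Finset.univ.filter fun j => ∀ y, x 1 = f y → y j ≠ 0)), ?_⟩
    intro j y hy
    simp only [Finset.mem_filter, Finset.mem_univ, true_and]
    refine ⟨fun h => h y hy, fun h => ?_⟩
    push Not at h
    obtain ⟨y', hy', h0⟩ := h
    obtain rfl := hinj (hy.symm.trans hy')
    rw [h0]
    exact zero_ne_one

lemma le_coverDMap_faceCover {G : Type*} [Group G] {Z : Type*} [TopologicalSpace Z]
    {n d : ℕ} {f : (Fin n → Set.Icc (0 : ℝ) 1) → Z} (hf : Continuous f)
    (ρ : ContPseudoMetric (G → Z)) (F : Finset G)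
    (δ : ℝ) (σ : G → Equiv.Perm (Fin d))
    (hmem : ∀ z : Fin d → Z, (fun a t => z (σ t⁻¹ a)) ∈ MapSpace ρ F δ σ) :
    (((n * d : ℕ) : ℝ) : EReal) ≤ coverDMap (faceCover G f) ρ F δ σ := by
  refine le_iInf₂ fun 𝒱 h𝒱 => ?_
  obtain ⟨⟨hopen, hcov⟩, href⟩ := h𝒱
  set h : (Fin n × Fin d → Set.Icc (0 : ℝ) 1) → MapSpace ρ F δ σ := fun u =>
    ⟨_, hmem fun a => f fun j => u (j, a)⟩ with hh
  have hcont : Continuous h := by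
    refine Continuous.subtype_mk ?_ _
    exact continuous_pi fun a => continuous_pi fun t => hf.comp (by fun_prop)
  have hcover : IsFinOpenCover (𝒱.image fun V => h ⁻¹' V) := by
    refine ⟨?_, ?_⟩
    · simp only [Finset.mem_image, forall_exists_index, and_imp]
      rintro _ V hV rfl
      exact (hopen V hV).preimage hcont
    · refine Set.eq_univ_of_forall fun u => ?_
      obtain ⟨V, hV, hu⟩ := Set.mem_iUnion₂.1 (hcov.symm ▸ Set.mem_univ (h u))
      exact Set.mem_iUnion₂.2 ⟨_, Finset.mem_image_of_mem _ hV, hu⟩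
  obtain ⟨y, hy⟩ := exists_card_filter_mem_of_cube _ hcover (by
    simp only [Finset.mem_image, forall_exists_index, and_imp]
    rintro _ V hV rfl ⟨j, a⟩ u hu v hv hu0 hv1
    obtain ⟨U, hU, hVU⟩ := href V hV
    simp only [restrictCover, prodCover, Finset.mem_image, Fintype.mem_piFinset,
      exists_exists_and_eq_and] at hU
    obtain ⟨W, hW, rfl⟩ := hU
    have hW' := hW ((σ 1).symm a)
    simp only [faceCover, Finset.mem_image, Finset.mem_univ, true_and] at hW'
    obtain ⟨T, hT⟩ := hW'
    have key : ∀ w, h w ∈ V → (j ∈ T → w (j, a) ≠ 0) ∧ (j ∉ T → w (j, a) ≠ 1) := by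
      intro w hw
      have h1 := hVU hw ((σ 1).symm a)
      rw [← hT] at h1
      exact h1 j (fun j => w (j, a)) (by simp [hh])
    by_cases hj : j ∈ T
    · exact (key u hu).1 hj hu0
    · exact (key v hv).2 hj hv1)
  rw [Fintype.card_prod, Fintype.card_fin, Fintype.card_fin] at hy
  refine coverOrd_ge_of_card (y := h y) (hy.trans ?_)
  rw [Finset.filter_image]
  exact Finset.card_image_le

/-- If `Z` contains an `n`-cube, the shift on `Z^G` has sofic mean dimension at least `n`. -/
theorem le_mdimSigma_of_cube {G : Type*} [Group G] (Sap : SoficApprox G) {Z : Type*}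
    [TopologicalSpace Z] [CompactSpace Z] [T2Space Z] (ρ : ContPseudoMetric (G → Z)) {n : ℕ}
    {f : (Fin n → Set.Icc (0 : ℝ) 1) → Z} (hf : Continuous f) (hinj : Function.Injective f) :
    ((n : ℝ) : EReal) ≤ mdimSigma Sap ρ := by
  refine le_trans ?_ (le_iSup₂ (f := fun 𝒰 (_ : 𝒰 ∈ {𝒰 : Finset (Set (G → Z)) |
    IsFinOpenCover 𝒰}) => DSigmaU Sap 𝒰 ρ) (faceCover G f) (isFinOpenCover_faceCover G hf hinj))
  refine le_iInf fun F => le_iInf fun δ => ?_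
  refine le_limsup_of_frequently_le (Eventually.frequently ?_)
  filter_upwards [eventually_forall_mem_mapSpace Sap ρ F.1 δ.2, Sap.eventually_pos] with i hi hd
  refine le_trans (le_of_eq ?_) (mul_le_mul_of_nonneg_right
    (le_coverDMap_faceCover hf ρ F.1 δ.1 (Sap.σ i) hi) ?_)
  · have : (Sap.d i : ℝ) ≠ 0 := by positivity
    rw [← EReal.coe_inv, ← EReal.coe_mul]
    rw [Nat.cast_mul, mul_inv_cancel_right₀ this]
  · rw [← EReal.coe_inv]
    exact_mod_cast (by positivity : (0 : ℝ) ≤ (Sap.d i : ℝ)⁻¹)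

lemma ContPseudoMetric.exists_sq_le {X : Type*} [TopologicalSpace X] [CompactSpace X]
    {ρ : ContPseudoMetric X} (hρ : ρ.IsCompatMetric) (ρ' : ContPseudoMetric X) {η : ℝ}
    (hη : 0 < η) : ∃ C : ℝ, 0 ≤ C ∧ ∀ x y, ρ'.d x y ^ 2 ≤ η ^ 2 + C * ρ.d x y ^ 2 := by
  obtain ⟨M, hM0, hM⟩ := ρ'.exists_bound
  have hK : IsCompact {p : X × X | η ≤ ρ'.d p.1 p.2} :=
    (isClosed_le continuous_const ρ'.continuous').isCompact
  obtain ⟨κ, hκ, hmin⟩ : ∃ κ > 0, ∀ p : X × X, η ≤ ρ'.d p.1 p.2 → κ ≤ ρ.d p.1 p.2 := by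
    refine hK.exists_forall_le' ρ.continuous'.continuousOn fun p hp => ?_
    refine lt_of_le_of_ne (ρ.nonneg _ _) fun h => ?_
    have hp' : η ≤ ρ'.d p.1 p.2 := hp
    rw [hρ _ _ h.symm, ρ'.refl] at hp'
    exact absurd hp' hη.not_ge
  refine ⟨M ^ 2 / κ ^ 2, by positivity, fun x y => ?_⟩
  rcases le_or_gt η (ρ'.d x y) with h | h
  · have h1 : κ ^ 2 ≤ ρ.d x y ^ 2 := pow_le_pow_left₀ hκ.le (hmin (x, y) h) 2
    have h2 : ρ'.d x y ^ 2 ≤ M ^ 2 := pow_le_pow_left₀ (ρ'.nonneg _ _) (hM x y) 2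
    have h3 : M ^ 2 ≤ M ^ 2 / κ ^ 2 * ρ.d x y ^ 2 := by
      rw [div_mul_eq_mul_div, le_div_iff₀ (by positivity)]
      gcongr
    nlinarith [sq_nonneg η]
  · have h2 : ρ'.d x y ^ 2 ≤ η ^ 2 := pow_le_pow_left₀ (ρ'.nonneg _ _) h.le 2
    have : 0 ≤ M ^ 2 / κ ^ 2 * ρ.d x y ^ 2 := by positivity
    linarith

lemma exists_mapSpace_subset {G X : Type*} [Group G] [TopologicalSpace X] [CompactSpace X]
    [MulAction G X] {ρ : ContPseudoMetric X} (hρ : ρ.IsCompatMetric) (ρ' : ContPseudoMetric X)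
    {δ' : ℝ} (hδ' : 0 < δ') : ∃ δ > 0, ∀ (F : Finset G) (d : ℕ) (σ : G → Equiv.Perm (Fin d)),
      MapSpace ρ F δ σ ⊆ MapSpace ρ' F δ' σ := by
  obtain ⟨C, hC, h⟩ := ρ.exists_sq_le hρ ρ' (half_pos hδ')
  have hδ : 0 < δ' / (2 * (C + 1)) := by positivity
  refine ⟨_, hδ, fun F d σ φ hφ s hs => ?_⟩
  have h1 := (Real.sqrt_le_iff.1 (hφ s hs)).2
  refine Real.sqrt_le_iff.2 ⟨hδ'.le, ?_⟩
  have h2 : C * (δ' / (2 * (C + 1))) ^ 2 ≤ (δ' / 2) ^ 2 := by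
    rw [div_pow, mul_pow, div_pow, ← mul_div_assoc, div_le_div_iff₀ (by positivity) (by positivity)]
    nlinarith [sq_nonneg δ', mul_nonneg hC (sq_nonneg δ'), mul_nonneg (mul_nonneg hC hC) (sq_nonneg δ')]
  have hd1 : 1 / (d : ℝ) * d ≤ 1 := by
    rcases Nat.eq_zero_or_pos d with rfl | hd
    · simp
    · rw [one_div, inv_mul_cancel₀ (by positivity)]
  calc _ ≤ 1 / (d : ℝ) * ∑ a : Fin d,
        ((δ' / 2) ^ 2 + C * ρ.d (φ (σ s a)) (s • φ a) ^ 2) := by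
        gcongr with a
        exact h _ _
    _ = (1 / (d : ℝ) * d) * (δ' / 2) ^ 2 +
        C * (1 / (d : ℝ) * ∑ a : Fin d, ρ.d (φ (σ s a)) (s • φ a) ^ 2) := by
        rw [Finset.sum_add_distrib, ← Finset.mul_sum]
        simp only [Finset.sum_const, Finset.card_univ, Fintype.card_fin, nsmul_eq_mul]
        ring
    _ ≤ 1 * (δ' / 2) ^ 2 + C * (δ' / (2 * (C + 1))) ^ 2 := by gcongr
    _ ≤ δ' ^ 2 := by nlinarith [sq_nonneg δ']

/-- Threshold covers: a finite family of continuous functions, few of which take values strictly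
between `0` and `1` at any given point, yields an open cover of small order. -/
lemma exists_threshold_cover {Y J : Type*} [TopologicalSpace Y] [Fintype J] (u : J → Y → ℝ)
    (hu : ∀ j, Continuous (u j)) (m : ℕ)
    (hm : ∀ y, (Finset.univ.filter fun j => 0 < u j y ∧ u j y < 1).card < m) :
    ∃ 𝒱 : Finset (Set Y), IsFinOpenCover 𝒱 ∧
      (∀ V ∈ 𝒱, V.Nonempty ∧ ∃ A : Finset J, ∀ y ∈ V, ∀ j,
        (j ∈ A → 0 < u j y) ∧ (j ∉ A → u j y < 1)) ∧
      ∀ y, (𝒱.filter fun V => y ∈ V).card ≤ m := by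
  set O : Finset J → Set Y := fun A =>
    ⋃ c ∈ Set.Ioo (0 : ℝ) 1, ⋂ j, {y | if j ∈ A then c < u j y else u j y < c} with hO
  have hmem : ∀ A y, y ∈ O A ↔ ∃ c : ℝ, 0 < c ∧ c < 1 ∧
      ∀ j, (j ∈ A → c < u j y) ∧ (j ∉ A → u j y < c) := by
    intro A y
    simp only [hO, Set.mem_iUnion, Set.mem_Ioo, Set.mem_iInter, Set.mem_ofPred_eq, exists_prop,
      and_assoc]
    refine exists_congr fun c => and_congr_right fun _ => and_congr_right fun _ =>
      forall_congr' fun j => ?_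
    by_cases hj : j ∈ A <;> simp [hj]
  refine ⟨(Finset.univ.image O).filter Set.Nonempty, ⟨?_, ?_⟩, ?_, ?_⟩
  · intro V hV
    obtain ⟨A, -, rfl⟩ := Finset.mem_image.1 (Finset.mem_filter.1 hV).1
    refine isOpen_biUnion fun c _ => isOpen_iInter_of_finite fun j => ?_
    by_cases hj : j ∈ A
    · simpa [hj] using isOpen_lt continuous_const (hu j)
    · simpa [hj] using isOpen_lt (hu j) continuous_const
  · refine Set.eq_univ_of_forall fun y => ?_
    obtain ⟨c, hc, hcu⟩ := (Set.Ioo_infinite (zero_lt_one (α := ℝ))).exists_notMem_finset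
      (Finset.univ.image fun j => u j y)
    have hy : y ∈ O (Finset.univ.filter fun j => c < u j y) := by
      refine (hmem _ _).2 ⟨c, hc.1, hc.2, fun j => ⟨fun hj => (Finset.mem_filter.1 hj).2,
        fun hj => ?_⟩⟩
      simp only [Finset.mem_filter, Finset.mem_univ, true_and, not_lt] at hj
      refine lt_of_le_of_ne hj fun h => hcu ?_
      exact Finset.mem_image.2 ⟨j, Finset.mem_univ _, h⟩
    exact Set.mem_iUnion₂.2 ⟨_, Finset.mem_filter.2
      ⟨Finset.mem_image_of_mem _ (Finset.mem_univ _), ⟨y, hy⟩⟩, hy⟩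
  · intro V hV
    obtain ⟨hV, hne⟩ := Finset.mem_filter.1 hV
    obtain ⟨A, -, rfl⟩ := Finset.mem_image.1 hV
    refine ⟨hne, A, fun y hy j => ?_⟩
    obtain ⟨c, h0, h1, h⟩ := (hmem _ _).1 hy
    exact ⟨fun hj => h0.trans ((h j).1 hj), fun hj => ((h j).2 hj).trans h1⟩
  · intro y
    set M := Finset.univ.filter fun j => 0 < u j y ∧ u j y < 1 with hM
    have hsub : (((Finset.univ.image O).filter Set.Nonempty).filter fun V => y ∈ V) ⊆
        (Finset.univ.filter fun A => y ∈ O A).image O := by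
      intro V hV
      obtain ⟨hV, hy⟩ := Finset.mem_filter.1 hV
      obtain ⟨A, -, rfl⟩ := Finset.mem_image.1 (Finset.mem_filter.1 hV).1
      exact Finset.mem_image_of_mem _ (Finset.mem_filter.2 ⟨Finset.mem_univ _, hy⟩)
    refine (Finset.card_le_card hsub).trans (Finset.card_image_le.trans ?_)
    refine le_trans ?_ (hm y)
    refine le_trans (Finset.card_le_card_of_injOn (fun A => (A ∩ M).card)
      (t := Finset.range (M.card + 1)) ?_ ?_) (Finset.card_range _).le
    · intro A _
      simpa [Nat.lt_succ_iff] using Finset.card_le_card Finset.inter_subset_right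
    · have key : ∀ A B : Finset J, ∀ c c' : ℝ, c ≤ c' → 0 < c → c' < 1 →
          (∀ j, (j ∈ A → c < u j y) ∧ (j ∉ A → u j y < c)) →
          (∀ j, (j ∈ B → c' < u j y) ∧ (j ∉ B → u j y < c')) →
          (A ∩ M).card = (B ∩ M).card → A = B := by
        intro A B c c' hcc h0 h1 hA hB hcard
        have hBA : B ⊆ A := fun j hj => by
          by_contra hjA
          exact absurd (((hA j).2 hjA).trans_le hcc) ((hB j).1 hj).not_gt
        have heq := Finset.eq_of_subset_of_card_le
          (Finset.inter_subset_inter_right hBA (u := M)) hcard.le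
        refine Finset.Subset.antisymm (fun j hj => ?_) hBA
        by_contra hjB
        have : j ∈ A ∩ M := Finset.mem_inter.2 ⟨hj, Finset.mem_filter.2
          ⟨Finset.mem_univ _, h0.trans ((hA j).1 hj), ((hB j).2 hjB).trans h1⟩⟩
        rw [← heq] at this
        exact hjB (Finset.mem_inter.1 this).1
      intro A hA B hB hAB
      obtain ⟨c, h0, h1, h⟩ := (hmem _ _).1 (Finset.mem_filter.1 hA).2
      obtain ⟨c', h0', h1', h'⟩ := (hmem _ _).1 (Finset.mem_filter.1 hB).2
      rcases le_total c c' with hcc | hcc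
      · exact key A B c c' hcc h0 h1' h h' hAB
      · exact (key B A c' c hcc h0' h1 h' h hAB.symm).symm

/-- A counting argument choosing grid points that few coordinates of each given vector match. -/
lemma exists_forall_card_match_lt {α J : Type*} [Fintype J] {q m : ℕ} (hq : 0 < q) (E : Finset α)
    (R : α → J → Fin q → Prop) (hR : ∀ e j i i', R e j i → R e j i' → i = i')
    (h : E.card * 2 ^ Fintype.card J < q ^ m) :
    ∃ ξ : J → Fin q, ∀ e ∈ E, (Finset.univ.filter fun j => R e j (ξ j)).card < m := by
  by_contra! hcon
  have hlow : q ^ Fintype.card J * q ^ m ≤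
      ∑ ξ : J → Fin q, ∑ e ∈ E, ∏ j, (if R e j (ξ j) then q else 1) := by
    have : ∀ ξ : J → Fin q, q ^ m ≤ ∑ e ∈ E, ∏ j, (if R e j (ξ j) then q else 1) := by
      intro ξ
      obtain ⟨e, he, hle⟩ := hcon ξ
      refine le_trans ?_ (Finset.single_le_sum
        (f := fun e => ∏ j, (if R e j (ξ j) then q else 1)) (fun _ _ => Nat.zero_le _) he)
      rw [Finset.prod_ite, Finset.prod_const, Finset.prod_const_one, mul_one]
      exact Nat.pow_le_pow_right hq hle
    calc _ = ∑ _ξ : J → Fin q, q ^ m := by simp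
      _ ≤ _ := Finset.sum_le_sum fun ξ _ => this ξ
  have hup : ∑ ξ : J → Fin q, ∑ e ∈ E, ∏ j, (if R e j (ξ j) then q else 1) ≤
      E.card * (2 * q) ^ Fintype.card J := by
    rw [Finset.sum_comm, ← smul_eq_mul]
    refine Finset.sum_le_card_nsmul _ _ _ fun e _ => ?_
    have hprod := Finset.prod_univ_sum (fun _ : J => (Finset.univ : Finset (Fin q)))
      (fun j i => if R e j i then q else 1)
    rw [Fintype.piFinset_univ] at hprod
    rw [← hprod, ← Finset.card_univ, ← Finset.prod_const]
    refine Finset.prod_le_prod' fun j _ => ?_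
    rw [Finset.sum_ite, Finset.sum_const, Finset.sum_const, smul_eq_mul, smul_eq_mul, mul_one,
      two_mul]
    refine add_le_add ?_ ?_
    · refine Nat.mul_le_of_le_div _ _ _ ?_
      rw [Nat.div_self hq]
      exact Finset.card_le_one.2 fun i hi i' hi' =>
        hR e j i i' (Finset.mem_filter.1 hi).2 (Finset.mem_filter.1 hi').2
    · exact (Finset.card_filter_le _ _).trans (by simp)
  have := hlow.trans hup
  rw [mul_pow, ← mul_assoc, mul_comm] at this
  exact absurd (Nat.le_of_mul_le_mul_right this (pow_pos hq _)) h.not_ge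

/-- Lipschitz bump functions subordinate to an open cover. -/
lemma ContPseudoMetric.exists_bump {X : Type*} [TopologicalSpace X] [CompactSpace X]
    {ρ : ContPseudoMetric X} (hρ : ρ.IsCompatMetric) {𝒰 : Finset (Set X)}
    (h𝒰 : IsFinOpenCover 𝒰) : ∃ (s : Finset X) (g : X → X → ℝ) (L : ℝ), 0 < L ∧
      (∀ k ∈ s, ∀ x y, |g k x - g k y| ≤ L * ρ.d x y) ∧
      (∀ k ∈ s, ∃ U ∈ 𝒰, ∀ x, 0 < g k x → x ∈ U) ∧ ∀ x, ∃ k ∈ s, 1 ≤ g k x := by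
  have hball : ∀ x, ∃ r > 0, ∃ U ∈ 𝒰, ∀ y, ρ.d x y < 2 * r → y ∈ U := by
    intro x
    obtain ⟨U, hU, hx⟩ := Set.mem_iUnion₂.1 (h𝒰.2.symm ▸ Set.mem_univ x)
    obtain ⟨κ, hκ, hmin⟩ := (h𝒰.1 U hU).isClosed_compl.isCompact.exists_forall_le'
      (f := fun y => ρ.d x y) (a := 0)
      (ρ.continuous'.comp (Continuous.prodMk_right x)).continuousOn (fun y hy => by
        refine lt_of_le_of_ne (ρ.nonneg _ _) fun h => hy ?_
        rwa [← hρ _ _ h.symm])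
    refine ⟨κ / 2, half_pos hκ, U, hU, fun y hy => ?_⟩
    by_contra hyU
    have := hmin y hyU
    linarith
  choose r hr U hU hrU using hball
  obtain ⟨s, hs⟩ := isCompact_univ.elim_finite_subcover (fun x => {y | ρ.d x y < r x})
    (fun x => isOpen_lt (ρ.continuous'.comp (Continuous.prodMk_right x)) continuous_const)
    (fun x _ => Set.mem_iUnion.2 ⟨x, by
      change ρ.d x x < r x
      rw [ρ.refl]; exact hr x⟩)
  refine ⟨s, fun k x => 2 - (r k)⁻¹ * ρ.d k x, ∑ k ∈ s, (r k)⁻¹ + 1, ?_, ?_, ?_, ?_⟩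
  · have := Finset.sum_nonneg fun k (_ : k ∈ s) => (inv_pos.2 (hr k)).le
    linarith
  · intro k hk x y
    have h1 : |ρ.d k x - ρ.d k y| ≤ ρ.d x y := by
      rw [abs_sub_le_iff]
      have h2 := ρ.triangle k y x
      have h3 := ρ.triangle k x y
      rw [ρ.symm y x] at h2
      constructor <;> linarith
    have h2 : (r k)⁻¹ ≤ ∑ k ∈ s, (r k)⁻¹ + 1 :=
      (Finset.single_le_sum (f := fun k => (r k)⁻¹)
        (fun k _ => (inv_pos.2 (hr k)).le) hk).trans (by linarith)
    rw [sub_sub_sub_cancel_left, ← mul_sub, abs_mul, abs_sub_comm, abs_of_pos (inv_pos.2 (hr k))]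
    exact mul_le_mul h2 h1 (abs_nonneg _) ((inv_pos.2 (hr k)).le.trans h2)
  · intro k _
    refine ⟨U k, hU k, fun x hx => hrU k x ?_⟩
    have h1 : (r k)⁻¹ * ρ.d k x < 2 := by linarith
    rwa [inv_mul_lt_iff₀ (hr k), mul_comm] at h1
  · intro x
    obtain ⟨k, hk, hx⟩ := Set.mem_iUnion₂.1 (hs (Set.mem_univ x))
    refine ⟨k, hk, ?_⟩
    have h1 : (r k)⁻¹ * ρ.d k x ≤ 1 := by
      rw [inv_mul_le_iff₀ (hr k), mul_one]
      exact le_of_lt hx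
    linarith

lemma le_rhoInfty {X : Type*} [TopologicalSpace X] (ρ : ContPseudoMetric X) {d : ℕ}
    (φ ψ : Fin d → X) (a : Fin d) : ρ.d (φ a) (ψ a) ≤ rhoInfty ρ φ ψ :=
  le_ciSup (f := fun a => ρ.d (φ a) (ψ a)) (Set.finite_range _).bddAbove a

/-- A maximal separated set spans. -/
lemma exists_spanning_of_sepNum_eq {X : Type*} [TopologicalSpace X] (ρ : ContPseudoMetric X)
    {d : ℕ} (T : Set (Fin d → X)) {ε : ℝ} (hε : 0 < ε) {K : ℕ}
    (hK : sepNum (fun φ ψ : T => rhoInfty ρ φ.1 ψ.1) ε = K) :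
    ∃ E : Finset T, E.card = K ∧ ∀ φ : T, ∃ e ∈ E, rhoInfty ρ φ.1 e.1 < ε := by
  obtain ⟨E, hE, hcard⟩ : ∃ E : Set T, (∀ x ∈ E, ∀ y ∈ E, x ≠ y → ε ≤ rhoInfty ρ x.1 y.1) ∧
      E.encard = K := by
    have hlt : sepNum (fun φ ψ : T => rhoInfty ρ φ.1 ψ.1) ε < ⊤ := by
      rw [hK]; exact ENat.natCast_lt_top K
    have : Nonempty {E : Set T // E ∈ {E : Set T | ∀ x ∈ E, ∀ y ∈ E, x ≠ y →
        ε ≤ rhoInfty ρ x.1 y.1}} := ⟨∅, by simp⟩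
    rw [sepNum, iSup_subtype'] at hlt hK
    obtain ⟨⟨E, hE⟩, h⟩ := ENat.exists_eq_iSup_of_lt_top hlt
    exact ⟨E, hE, h.trans hK⟩
  have hfin : E.Finite := Set.finite_of_encard_eq_coe hcard
  refine ⟨hfin.toFinset, ?_, fun φ => ?_⟩
  · rw [hfin.encard_eq_coe_toFinset_card] at hcard
    exact_mod_cast hcard
  · by_contra! hcon
    simp only [Set.Finite.mem_toFinset] at hcon
    have hnot : φ ∉ E := fun h => by
      have := hcon φ h
      simp only [rhoInfty, ρ.refl, Real.iSup_const_zero] at this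
      exact absurd this hε.not_ge
    have hsep : ∀ x ∈ insert φ E, ∀ y ∈ insert φ E, x ≠ y → ε ≤ rhoInfty ρ x.1 y.1 := by
      rintro x (rfl | hx) y (rfl | hy) hne
      · exact absurd rfl hne
      · exact hcon y hy
      · have := hcon x hx
        simp only [rhoInfty] at this ⊢
        simpa only [ρ.symm] using this
      · exact hE x hx y hy hne
    have hle : (insert φ E).encard ≤ K := by
      rw [← hK]
      exact le_iSup₂ (f := fun (E : Set T) (_ : E ∈ {E : Set T | ∀ x ∈ E, ∀ y ∈ E, x ≠ y →
        ε ≤ rhoInfty ρ x.1 y.1}) => E.encard) _ hsep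
    rw [Set.encard_insert_of_notMem hnot, hcard] at hle
    exact absurd (by exact_mod_cast hle : K + 1 ≤ K) (Nat.not_succ_le_self K)

lemma coverOrd_le_of_card {Y : Type*} {𝒱 : Finset (Set Y)} {m : ℕ}
    (h : ∀ y, (𝒱.filter fun V => y ∈ V).card ≤ m) : coverOrd 𝒱 ≤ ((m - 1 : ℝ) : EReal) := by
  rw [EReal.coe_sub]
  refine EReal.sub_le_sub (iSup_le fun y => ?_) le_rfl
  exact_mod_cast h y

lemma coverD_of_isEmpty {Y : Type*} [TopologicalSpace Y] [IsEmpty Y] (𝒰 : Finset (Set Y)) :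
    coverD 𝒰 = ⊥ := by
  have hcov : IsFinOpenCover (∅ : Finset (Set Y)) :=
    ⟨by simp, Set.eq_univ_of_forall fun y => (IsEmpty.false y).elim⟩
  have href : Refines (∅ : Finset (Set Y)) 𝒰 := fun V hV => by simp at hV
  refine le_bot_iff.1 (le_trans (iInf₂_le (∅ : Finset (Set Y)) ⟨hcov, href⟩) ?_)
  simp [coverOrd]

/-- Separated sets of bounded size bound the order of refinements of the product cover. -/
lemma coverD_restrict_le {X : Type*} [TopologicalSpace X] {ρ : ContPseudoMetric X}
    {𝒰 : Finset (Set X)} {s : Finset X} {g : X → X → ℝ} {L : ℝ} (hL : 0 < L)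
    (hlip : ∀ k ∈ s, ∀ x y, |g k x - g k y| ≤ L * ρ.d x y)
    (hsub : ∀ k ∈ s, ∃ U ∈ 𝒰, ∀ x, 0 < g k x → x ∈ U) (hone : ∀ x, ∃ k ∈ s, 1 ≤ g k x)
    {d : ℕ} {S T : Set (Fin d → X)} (hST : S ⊆ T) {ε : ℝ} (hε : 0 < ε) {q m K : ℕ} (hq : 0 < q)
    (hqε : 4 * q * (L * ε) ≤ 1) (hK : sepNum (fun φ ψ : T => rhoInfty ρ φ.1 ψ.1) ε = K)
    (hm : K * 2 ^ (s.card * d) < q ^ m) :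
    coverD (restrictCover (prodCover 𝒰 d) S) ≤ ((m - 1 : ℝ) : EReal) := by
  obtain ⟨E, hE, hspan⟩ := exists_spanning_of_sepNum_eq ρ T hε hK
  set τ := L * ε with hτ
  have hτ0 : 0 < τ := mul_pos hL hε
  have hgc : ∀ k ∈ s, Continuous (g k) := by
    intro k hk
    refine continuous_iff_continuousAt.2 fun x => ?_
    refine tendsto_iff_dist_tendsto_zero.2 (squeeze_zero (fun _ => dist_nonneg)
      (fun y => (Real.dist_eq _ _).trans_le (hlip k hk y x)) ?_)
    have : Continuous fun y => L * ρ.d y x :=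
      continuous_const.mul (ρ.continuous'.comp (Continuous.prodMk_left x))
    simpa [ρ.refl] using this.tendsto x
  obtain ⟨ξ, hξ⟩ := exists_forall_card_match_lt (J := s × Fin d) hq E
    (fun e j i => |g j.1 (e.1 j.2) - (4 * i + 1) * τ| < 2 * τ) (by
      intro e j i i' h h'
      rw [abs_lt] at h h'
      have h1 : ((i : ℕ) : ℝ) < (i' : ℕ) + 1 := by nlinarith [h.1, h'.2]
      have h2 : ((i' : ℕ) : ℝ) < (i : ℕ) + 1 := by nlinarith [h'.1, h.2]
      have h1' : (i : ℕ) < i' + 1 := by exact_mod_cast h1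
      have h2' : (i' : ℕ) < i + 1 := by exact_mod_cast h2
      exact Fin.ext (by omega)) (m := m) (by simpa [hE] using hm)
  set u : s × Fin d → S → ℝ := fun j φ =>
    (g j.1 (φ.1 j.2) - (4 * (ξ j : ℕ) + 1) * τ + τ) / (2 * τ) with hu
  obtain ⟨𝒱, hcov, hform, hmult⟩ := exists_threshold_cover u (fun j => by
    have := hgc j.1 j.1.2
    have h2 : Continuous fun φ : S => φ.1 j.2 := (continuous_apply j.2).comp continuous_subtype_val
    have h3 := this.comp h2
    simp only [hu]
    exact ((h3.sub continuous_const).add continuous_const).div_const _) m (by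
    intro φ
    obtain ⟨e, he, hlt⟩ := hspan ⟨φ.1, hST φ.2⟩
    refine lt_of_le_of_lt (Finset.card_le_card fun j hj => ?_) (hξ e he)
    simp only [Finset.mem_filter, Finset.mem_univ, true_and] at hj ⊢
    have h1 := hlip j.1 j.1.2 (φ.1 j.2) (e.1 j.2)
    have h2 : L * ρ.d (φ.1 j.2) (e.1 j.2) < τ :=
      mul_lt_mul_of_pos_left ((le_rhoInfty ρ _ _ _).trans_lt hlt) hL
    have h3 := abs_lt.1 (h1.trans_lt h2)
    rw [div_pos_iff_of_pos_right (by positivity), div_lt_one (by positivity)] at hj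
    rw [abs_lt]
    constructor <;> linarith [hj.1, hj.2, h3.1, h3.2])
  refine (iInf₂_le 𝒱 ⟨hcov, fun V hV => ?_⟩).trans (coverOrd_le_of_card hmult)
  obtain ⟨⟨φ, hφ⟩, A, hA⟩ := hform V hV
  have hk : ∀ a, ∃ U ∈ 𝒰, ∀ ψ ∈ V, ψ.1 a ∈ U := by
    intro a
    obtain ⟨k, hks, hk1⟩ := hone (φ.1 a)
    obtain ⟨U, hU, hgU⟩ := hsub k hks
    refine ⟨U, hU, fun ψ hψ => hgU _ ?_⟩
    have hjA : ((⟨k, hks⟩, a) : s × Fin d) ∈ A := by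
      by_contra hj
      have h1 := (hA φ hφ _).2 hj
      rw [div_lt_one (by positivity)] at h1
      have hle : ((ξ (⟨k, hks⟩, a) : ℕ) : ℝ) + 1 ≤ q := by
        exact_mod_cast (ξ (⟨k, hks⟩, a)).2
      have := mul_le_mul_of_nonneg_right hle hτ0.le
      simp only at h1
      nlinarith
    have h1 := (hA ψ hψ _).1 hjA
    rw [div_pos_iff_of_pos_right (by positivity)] at h1
    have : 0 ≤ ((ξ (⟨k, hks⟩, a) : ℕ) : ℝ) * τ := by positivity
    simp only at h1
    nlinarith
  choose U hU hVU using hk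
  refine ⟨_, Finset.mem_image_of_mem _ (Finset.mem_image_of_mem _
    (Fintype.mem_piFinset.2 hU)), fun ψ hψ a => hVU a ψ hψ⟩

lemma coverD_restrict_le_elog {X : Type*} [TopologicalSpace X] {ρ : ContPseudoMetric X}
    {𝒰 : Finset (Set X)} {s : Finset X} {g : X → X → ℝ} {L : ℝ} (hL : 0 < L)
    (hlip : ∀ k ∈ s, ∀ x y, |g k x - g k y| ≤ L * ρ.d x y)
    (hsub : ∀ k ∈ s, ∃ U ∈ 𝒰, ∀ x, 0 < g k x → x ∈ U) (hone : ∀ x, ∃ k ∈ s, 1 ≤ g k x)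
    {d : ℕ} {S T : Set (Fin d → X)} (hST : S ⊆ T) {ε : ℝ} (hε : 0 < ε) {q : ℕ} (hq : 1 < q)
    (hqε : 4 * q * (L * ε) ≤ 1) {h : ℝ} (hd : 0 < d)
    (hh : elog (sepNum (fun φ ψ : T => rhoInfty ρ φ.1 ψ.1) ε) * ((d : ℝ)⁻¹ : EReal) < (h : EReal)) :
    coverD (restrictCover (prodCover 𝒰 d) S) * ((d : ℝ)⁻¹ : EReal) ≤
      (((h + s.card * Real.log 2) / Real.log q : ℝ) : EReal) := by
  have hd' : (0 : ℝ) < d := by exact_mod_cast hd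
  have hlogq : 0 < Real.log q := Real.log_pos (by exact_mod_cast hq)
  rw [← EReal.coe_inv] at hh ⊢
  rcases hN : sepNum (fun φ ψ : T => rhoInfty ρ φ.1 ψ.1) ε with _ | K
  · rw [hN] at hh
    have : elog none = ⊤ := if_pos rfl
    rw [this, EReal.top_mul_coe_of_pos (by positivity)] at hh
    exact absurd hh not_top_lt
  change _ = (K : ℕ∞) at hN
  rw [hN] at hh
  rcases Nat.eq_zero_or_pos K with rfl | hK
  · have hS : IsEmpty S := ⟨fun φ => by
      obtain ⟨E, hE, hspan⟩ := exists_spanning_of_sepNum_eq ρ T hε hN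
      obtain ⟨e, he, -⟩ := hspan ⟨φ.1, hST φ.2⟩
      rw [Finset.card_eq_zero.1 hE] at he
      simp at he⟩
    rw [coverD_of_isEmpty, EReal.bot_mul_coe_of_pos (by positivity)]
    exact bot_le
  have helog : elog (K : ℕ∞) = ((Real.log K : ℝ) : EReal) := by
    simp [elog, hK.ne']
  rw [helog, ← EReal.coe_mul, EReal.coe_lt_coe_iff] at hh
  have hD := coverD_restrict_le hL hlip hsub hone hST hε (hq.le) hqε hN
    (Nat.lt_pow_succ_log_self hq (K * 2 ^ (s.card * d)))
  refine (mul_le_mul_of_nonneg_right hD (by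
    exact_mod_cast (inv_pos.2 hd').le)).trans ?_
  rw [← EReal.coe_mul, EReal.coe_le_coe_iff]
  have hlog : (Nat.log q (K * 2 ^ (s.card * d)) : ℝ) * Real.log q ≤
      Real.log K + s.card * d * Real.log 2 := by
    have h1 : ((q ^ Nat.log q (K * 2 ^ (s.card * d)) : ℕ) : ℝ) ≤ ((K * 2 ^ (s.card * d) : ℕ) : ℝ) := by
      exact_mod_cast Nat.pow_log_le_self q (by positivity)
    have h2 := Real.log_le_log (by positivity) h1
    push_cast at h2
    rw [Real.log_pow, Real.log_mul (by positivity) (by positivity), Real.log_pow] at h2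
    push_cast at h2
    exact h2
  rw [le_div_iff₀ hlogq]
  push_cast
  rw [add_sub_cancel_right, mul_right_comm]
  rw [← div_eq_mul_inv] at hh
  rw [div_lt_iff₀ hd'] at hh
  rw [← div_eq_mul_inv, div_le_iff₀ hd']
  nlinarith

lemma tendsto_inv_mul_nhdsGT_zero {L : ℝ} (hL : 0 < L) :
    Tendsto (fun ε : ℝ => (4 * L * ε)⁻¹) (𝓝[>] 0) atTop :=
  ((tendsto_inv_nhdsGT_zero (𝕜 := ℝ)).const_mul_atTop
    (inv_pos.2 (by positivity : 0 < 4 * L))).congr fun _ => (mul_inv _ _).symm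

lemma tendsto_div_log_floor {L : ℝ} (hL : 0 < L) (c C : ℝ) :
    Tendsto (fun ε : ℝ => (c * |Real.log ε| + C) / Real.log (⌊(4 * L * ε)⁻¹⌋₊ : ℝ)) (𝓝[>] 0)
      (𝓝 c) := by
  have ht : Tendsto (fun ε : ℝ => -Real.log ε) (𝓝[>] 0) atTop :=
    tendsto_neg_atBot_atTop.comp Real.tendsto_log_nhdsGT_zero
  have hx := tendsto_inv_mul_nhdsGT_zero hL
  have hfl : Tendsto (fun ε : ℝ => Real.log ((⌊(4 * L * ε)⁻¹⌋₊ : ℝ) / (4 * L * ε)⁻¹)) (𝓝[>] 0)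
      (𝓝 0) := by
    have h1 := (tendsto_nat_floor_div_atTop (R := ℝ)).comp hx
    have h2 := (Real.continuousAt_log one_ne_zero).tendsto.comp h1
    simpa [Function.comp_def] using h2
  have hnum : Tendsto (fun ε : ℝ => c + C / (-Real.log ε)) (𝓝[>] 0) (𝓝 (c + 0)) :=
    (ht.const_div_atTop C).const_add c
  have hden : Tendsto (fun ε : ℝ => 1 + (Real.log ((⌊(4 * L * ε)⁻¹⌋₊ : ℝ) / (4 * L * ε)⁻¹) -
      Real.log (4 * L)) / (-Real.log ε)) (𝓝[>] 0) (𝓝 (1 + 0)) :=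
    ((hfl.sub_const _).div_atTop ht).const_add 1
  have := hnum.div hden (by norm_num)
  simp only [add_zero, div_one] at this
  refine this.congr' ?_
  filter_upwards [ht.eventually_gt_atTop 0, hx.eventually_ge_atTop 1, self_mem_nhdsWithin]
    with ε hε hε1 hε0
  have hε0 : 0 < ε := hε0
  have hfloor : (0 : ℝ) < (⌊(4 * L * ε)⁻¹⌋₊ : ℝ) := by
    exact_mod_cast Nat.floor_pos.2 hε1
  have habs : |Real.log ε| = -Real.log ε := abs_of_neg (by linarith)
  simp only [Pi.div_apply]
  rw [habs, Real.log_div hfloor.ne' (by positivity), Real.log_inv,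
    Real.log_mul (by positivity) hε0.ne']
  have hne : Real.log ε ≠ 0 := by linarith
  have e1 : c + C / -Real.log ε = (c * -Real.log ε + C) / -Real.log ε := by
    field_simp
    ring
  have e2 : 1 + (Real.log (⌊(4 * L * ε)⁻¹⌋₊ : ℝ) - -(Real.log (4 * L) + Real.log ε) -
      Real.log (4 * L)) / -Real.log ε = Real.log (⌊(4 * L * ε)⁻¹⌋₊ : ℝ) / -Real.log ε := by
    field_simp
    ring
  rw [e1, e2, div_div_div_cancel_right₀ (by simpa using hne)]

/-- Sofic mean dimension is bounded by sofic mean metric dimension. -/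
theorem mdimSigma_le_mdimSigmaM {G X : Type*} [Group G] [TopologicalSpace X] [CompactSpace X]
    [MulAction G X] (Sap : SoficApprox G) {ρ ρ' : ContPseudoMetric X} (hρ : ρ.IsCompatMetric)
    (hρ' : ρ'.IsCompatMetric) : mdimSigma Sap ρ ≤ mdimSigmaM Sap ρ' := by
  refine iSup₂_le fun 𝒰 h𝒰 => ?_
  obtain ⟨s, g, L, hL, hlip, hsub, hone⟩ := ρ'.exists_bump hρ' h𝒰
  refine EReal.le_of_forall_lt_iff_le.1 fun c hc => ?_
  have hfreq := frequently_lt_of_liminf_lt (by isBoundedDefault) hc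
  refine ge_of_tendsto_of_frequently
    ((continuous_coe_real_ereal.tendsto c).comp
      (tendsto_div_log_floor hL c (s.card * Real.log 2))) ?_
  have hx := tendsto_inv_mul_nhdsGT_zero hL
  have hlt1 : ∀ᶠ ε : ℝ in 𝓝[>] 0, ε < 1 := eventually_nhdsWithin_of_eventually_nhds
    (eventually_lt_nhds zero_lt_one)
  refine (hfreq.and_eventually ((hx.eventually_ge_atTop 2).and
    (hlt1.and self_mem_nhdsWithin))).mono ?_
  rintro ε ⟨hε, hε2, hε1, hε0⟩
  have hε0 : 0 < ε := hε0
  have hlog : 0 < |Real.log ε| := abs_pos.2 (Real.log_neg hε0 hε1).ne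
  have hlt : hEps Sap ρ' ε < ((c * |Real.log ε| : ℝ) : EReal) := by
    by_contra! hcon
    have := mul_le_mul_of_nonneg_right hcon
      (by exact_mod_cast (inv_pos.2 hlog).le : (0 : EReal) ≤ ((|Real.log ε|⁻¹ : ℝ) : EReal))
    rw [← EReal.coe_mul, mul_inv_cancel_right₀ hlog.ne'] at this
    exact absurd hε this.not_gt
  obtain ⟨F, hF⟩ := iInf_lt_iff.1 hlt
  obtain ⟨δ', hδ'⟩ := iInf_lt_iff.1 hF
  obtain ⟨δ, hδ, hmap⟩ := exists_mapSpace_subset (G := G) hρ ρ' δ'.2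
  refine (iInf_le _ F).trans ((iInf_le _ ⟨δ, hδ⟩).trans ?_)
  refine limsup_le_of_le (by isBoundedDefault) ?_
  filter_upwards [eventually_lt_of_limsup_lt hδ', Sap.eventually_pos] with i hi hd
  have hfl : 1 < ⌊(4 * L * ε)⁻¹⌋₊ := Nat.le_floor (by exact_mod_cast hε2)
  refine coverD_restrict_le_elog hL hlip hsub hone (hmap F.1 _ (Sap.σ i)) hε0 hfl ?_ hd hi
  have h1 := Nat.floor_le (a := (4 * L * ε)⁻¹) (by positivity)
  calc 4 * (⌊(4 * L * ε)⁻¹⌋₊ : ℝ) * (L * ε) = ⌊(4 * L * ε)⁻¹⌋₊ * (4 * L * ε) := by ring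
    _ ≤ (4 * L * ε)⁻¹ * (4 * L * ε) := by gcongr
    _ = 1 := inv_mul_cancel₀ (by positivity)

lemma exists_fin_enumeration {ι : Type*} [Nonempty ι] {n : ℕ} (T : Finset ι) (hT : T.card ≤ n) :
    ∃ e : Fin n → ι, ∀ v ∈ T, ∃ k, e k = v := by
  obtain ⟨v₀⟩ := ‹Nonempty ι›
  refine ⟨fun k => T.toList.getD k v₀, fun v hv => ?_⟩
  obtain ⟨i, hi, rfl⟩ := List.getElem_of_mem (Finset.mem_toList.2 hv)
  refine ⟨⟨i, hi.trans_le (by simpa using hT)⟩, ?_⟩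
  exact List.getD_eq_getElem _ _ hi

lemma exists_refinement_of_covDim {Z : Type*} [TopologicalSpace Z] {n : ℕ} (hn : covDim Z = n)
    {𝒰 : Finset (Set Z)} (h𝒰 : IsFinOpenCover 𝒰) :
    ∃ 𝒱 : Finset (Set Z), IsFinOpenCover 𝒱 ∧ Refines 𝒱 𝒰 ∧
      ∀ z : Z, (𝒱.filter fun V => z ∈ V).card ≤ n + 1 := by
  have hne : {n : ℕ∞ | ∀ 𝒰 : Finset (Set Z), IsFinOpenCover 𝒰 →
      ∃ 𝒱 : Finset (Set Z), IsFinOpenCover 𝒱 ∧ Refines 𝒱 𝒰 ∧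
        ∀ y : Z, (((𝒱.filter fun V => y ∈ V).card : ℕ∞)) ≤ n + 1}.Nonempty :=
    ⟨⊤, fun 𝒰 h => ⟨𝒰, h, fun U hU => ⟨U, hU, le_rfl⟩, fun y => by simp⟩⟩
  have hmem := csInf_mem hne
  rw [← covDim, hn] at hmem
  obtain ⟨𝒱, h1, h2, h3⟩ := hmem 𝒰 h𝒰
  exact ⟨𝒱, h1, h2, fun z => by exact_mod_cast h3 z⟩

/-- On a compact space of covering dimension `n`, every continuous pseudometric is uniformly close
to one whose covering numbers at scale `1 / q` grow like `q ^ n`. -/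
lemma ContPseudoMetric.exists_approx_cells {Z : Type*} [TopologicalSpace Z] [CompactSpace Z]
    [T2Space Z] {n : ℕ} (hn : covDim Z = n) (ρ : ContPseudoMetric Z) {η : ℝ} (hη : 0 < η) :
    ∃ ρ' : ContPseudoMetric Z, (∀ x y, |ρ'.d x y - ρ.d x y| ≤ 4 * η) ∧
      ∃ (N : ℕ) (D : ℝ), 0 < D ∧ 0 < N ∧ ∀ q : ℕ, 0 < q →
        ∃ cell : Z → Fin (N * (q + 1) ^ n),
          ∀ x y, cell x = cell y → ρ'.d x y ≤ D / q := by
  obtain ⟨B, hB0, hB⟩ := ρ.exists_bound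
  have hopen : ∀ x, IsOpen {y | ρ.d x y < η / 2} := fun x =>
    isOpen_lt (ρ.continuous'.comp (Continuous.prodMk_right x)) continuous_const
  obtain ⟨s, hs⟩ := isCompact_univ.elim_finite_subcover (fun x => {y | ρ.d x y < η / 2}) hopen
    (fun x _ => Set.mem_iUnion.2 ⟨x, by
      change ρ.d x x < η / 2
      rw [ρ.refl]; exact half_pos hη⟩)
  obtain ⟨𝒱, ⟨h𝒱o, h𝒱c⟩, href, hmult⟩ := exists_refinement_of_covDim hn
    (𝒰 := s.image fun x => {y | ρ.d x y < η / 2}) ⟨by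
      simp only [Finset.mem_image, forall_exists_index, and_imp]
      rintro _ x _ rfl
      exact hopen x, by
      refine Set.eq_univ_of_forall fun y => ?_
      obtain ⟨x, hx, hy⟩ := Set.mem_iUnion₂.1 (hs (Set.mem_univ y))
      exact Set.mem_iUnion₂.2 ⟨_, Finset.mem_image_of_mem _ hx, hy⟩⟩
  have hsmall : ∀ V ∈ 𝒱, ∀ x ∈ V, ∀ y ∈ V, ρ.d x y ≤ η := by
    intro V hV x hx y hy
    obtain ⟨U, hU, hVU⟩ := href V hV
    obtain ⟨z, -, rfl⟩ := Finset.mem_image.1 hU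
    have h1 : ρ.d z x < η / 2 := hVU hx
    have h2 : ρ.d z y < η / 2 := hVU hy
    have h3 := ρ.triangle x z y
    rw [ρ.symm x z] at h3
    linarith
  let ι := {V : Set Z // V ∈ 𝒱 ∧ V.Nonempty}
  have : Finite ι := Finite.of_injective (fun V : ι => (⟨V.1, V.2.1⟩ : 𝒱)) (by
    intro V W h
    exact Subtype.ext (by simpa using h))
  have : Fintype ι := Fintype.ofFinite ι
  choose p hp using fun V : ι => V.2.2
  obtain ⟨f, hf⟩ := PartitionOfUnity.exists_isSubordinate_of_locallyFinite isClosed_univ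
    (fun V : ι => V.1) (fun V => h𝒱o _ V.2.1) (locallyFinite_of_finite _) (by
      intro z _
      obtain ⟨V, hV, hz⟩ := Set.mem_iUnion₂.1 (h𝒱c.symm ▸ Set.mem_univ z)
      exact Set.mem_iUnion.2 ⟨⟨V, hV, z, hz⟩, hz⟩)
  have hsum : ∀ x, ∑ v, f v x = 1 := fun x => by
    rw [← finsum_eq_sum_of_fintype]
    exact f.sum_eq_one (Set.mem_univ x)
  have hmemV : ∀ v x, f v x ≠ 0 → x ∈ v.1 := fun v x h =>
    hf v (subset_tsupport _ h)
  set H : Z → ι → ℝ := fun x w => ∑ v, f v x * ρ.d (p v) (p w) with hH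
  have hHc : Continuous H := continuous_pi fun w =>
    continuous_finsetSum _ fun v _ => (f v).continuous.mul continuous_const
  have hHapprox : ∀ x w, |H x w - ρ.d x (p w)| ≤ η := by
    intro x w
    have h1 : H x w - ρ.d x (p w) = ∑ v, f v x * (ρ.d (p v) (p w) - ρ.d x (p w)) := by
      simp_rw [mul_sub, Finset.sum_sub_distrib, ← Finset.sum_mul, hsum, one_mul, hH]
    rw [h1]
    calc _ ≤ ∑ v, |f v x * (ρ.d (p v) (p w) - ρ.d x (p w))| := Finset.abs_sum_le_sum_abs _ _
      _ ≤ ∑ v, f v x * η := by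
        refine Finset.sum_le_sum fun v _ => ?_
        rw [abs_mul, abs_of_nonneg (f.nonneg v x)]
        by_cases hv : f v x = 0
        · simp [hv]
        · refine mul_le_mul_of_nonneg_left ?_ (f.nonneg v x)
          have h2 := hsmall v.1 v.2.1 x (hmemV v x hv) (p v) (hp v)
          have h3 := ρ.triangle (p v) x (p w)
          have h4 := ρ.triangle x (p v) (p w)
          rw [ρ.symm (p v) x] at h3
          rw [abs_le]
          constructor <;> linarith
      _ = η := by rw [← Finset.sum_mul, hsum, one_mul]
  refine ⟨⟨fun x y => dist (H x) (H y), (hHc.comp continuous_fst).dist (hHc.comp continuous_snd),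
    fun _ _ => dist_nonneg, fun _ _ => dist_comm _ _, fun _ => dist_self _,
    fun _ _ _ => dist_triangle _ _ _⟩, ?_, ?_⟩
  · intro x y
    rw [abs_sub_le_iff]
    constructor
    · rw [sub_le_iff_le_add']
      refine (dist_pi_le_iff (by have := ρ.nonneg x y; positivity)).2 fun w => ?_
      have h1 := abs_le.1 (hHapprox x w)
      have h2 := abs_le.1 (hHapprox y w)
      have h3 := ρ.triangle x y (p w)
      have h4 := ρ.triangle y x (p w)
      rw [ρ.symm y x] at h4
      rw [Real.dist_eq, abs_le]
      constructor <;> linarith [h1.1, h1.2, h2.1, h2.2]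
    · obtain ⟨w, hw⟩ := f.exists_pos (Set.mem_univ x)
      have h0 := hsmall w.1 w.2.1 x (hmemV w x hw.ne') (p w) (hp w)
      have h1 := abs_le.1 (hHapprox x w)
      have h2 := abs_le.1 (hHapprox y w)
      have h3 := ρ.triangle x (p w) y
      rw [ρ.symm (p w) y] at h3
      have h4 : H y w - H x w ≤ dist (H x) (H y) := by
        refine le_trans ?_ (dist_le_pi_dist (H x) (H y) w)
        rw [dist_comm, Real.dist_eq]
        exact le_abs_self _
      change ρ.d x y - dist (H x) (H y) ≤ _
      linarith [h1.1, h1.2, h2.1, h2.2]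
  · refine ⟨2 ^ Fintype.card ι, n * B + 1, by positivity, by positivity, fun q hq => ?_⟩
    have hq' : (0 : ℝ) < q := by exact_mod_cast hq
    set T : Z → Finset ι := fun x => Finset.univ.filter fun v => f v x ≠ 0 with hT
    have hTcard : ∀ x, (T x).card ≤ n + 1 := by
      intro x
      refine le_trans (Finset.card_le_card_of_injOn (fun v : ι => v.1) ?_ ?_) (hmult x)
      · intro v hv
        exact Finset.mem_coe.2 (Finset.mem_filter.2
          ⟨v.2.1, hmemV v x (Finset.mem_filter.1 hv).2⟩)
      · exact Subtype.val_injective.injOn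
    have henum : ∀ x, ∃ e : (Fin n → ι) × ι, e.2 ∈ T x ∧ ∀ v ∈ (T x).erase e.2,
        ∃ k, e.1 k = v := by
      intro x
      obtain ⟨w, hw⟩ := f.exists_pos (Set.mem_univ x)
      have hwT : w ∈ T x := Finset.mem_filter.2 ⟨Finset.mem_univ _, hw.ne'⟩
      have : Nonempty ι := ⟨w⟩
      obtain ⟨e, he⟩ := exists_fin_enumeration (n := n) ((T x).erase w) (by
        rw [Finset.card_erase_of_mem hwT]
        have := hTcard x
        omega)
      exact ⟨(e, w), hwT, he⟩
    have henum' : ∀ S : Finset ι, (∃ x, T x = S) → ∃ e : (Fin n → ι) × ι, e.2 ∈ S ∧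
        ∀ v ∈ S.erase e.2, ∃ k, e.1 k = v := by
      rintro S ⟨x, rfl⟩
      exact henum x
    choose e he1 he2 using henum'
    have hfle : ∀ v x, f v x ≤ 1 := fun v x => f.le_one v x
    have hfloor : ∀ v x, ⌊q * f v x⌋₊ < q + 1 := by
      intro v x
      rw [Nat.lt_succ_iff]
      refine Nat.floor_le_of_le ?_
      nlinarith [hfle v x]
    let code : Z → Finset ι × (Fin n → Fin (q + 1)) := fun x =>
      (T x, fun k => ⟨⌊q * f ((e (T x) ⟨x, rfl⟩).1 k) x⌋₊, hfloor _ _⟩)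
    have hcard : Fintype.card (Finset ι × (Fin n → Fin (q + 1))) =
        2 ^ Fintype.card ι * (q + 1) ^ n := by simp
    refine ⟨fun x => (Fintype.equivFinOfCardEq hcard) (code x), fun x y hxy => ?_⟩
    have hcode : code x = code y := (Fintype.equivFinOfCardEq hcard).injective hxy
    have hTxy : T x = T y := congrArg Prod.fst hcode
    set t₀ := (e (T x) ⟨x, rfl⟩).2 with ht₀
    have hclose : ∀ v ∈ (T x).erase t₀, |f v x - f v y| ≤ 1 / q := by
      intro v hv
      obtain ⟨k, hk⟩ := he2 (T x) ⟨x, rfl⟩ v hv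
      have h1 : ⌊q * f ((e (T x) ⟨x, rfl⟩).1 k) x⌋₊ = ⌊q * f ((e (T y) ⟨y, rfl⟩).1 k) y⌋₊ := by
        have := congrFun (congrArg Prod.snd hcode) k
        exact congrArg Fin.val this
      have h2 : (e (T y) ⟨y, rfl⟩).1 k = v := by
        rw [← hk]
        simp only [hTxy]
      rw [h2, hk] at h1
      have h3 := Nat.floor_le (a := q * f v x) (mul_nonneg hq'.le (f.nonneg v x))
      have h4 := Nat.lt_floor_add_one (q * f v x)
      have h5 := Nat.floor_le (a := q * f v y) (mul_nonneg hq'.le (f.nonneg v y))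
      have h6 := Nat.lt_floor_add_one (q * f v y)
      rw [h1] at h3 h4
      rw [le_div_iff₀ hq', ← abs_of_pos hq', ← abs_mul, abs_le]
      constructor <;> nlinarith
    refine (dist_pi_le_iff (by positivity)).2 fun w => ?_
    have hdiff : H x w - H y w =
        ∑ v ∈ (T x).erase t₀, (f v x - f v y) * (ρ.d (p v) (p w) - ρ.d (p t₀) (p w)) := by
      have h1 : H x w - H y w =
          ∑ v, (f v x - f v y) * (ρ.d (p v) (p w) - ρ.d (p t₀) (p w)) := by
        simp_rw [mul_sub, sub_mul, Finset.sum_sub_distrib, ← Finset.sum_mul, hsum, sub_self,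
          sub_zero, hH]
      rw [h1]
      refine (Finset.sum_subset (Finset.subset_univ _) fun v _ hv => ?_).symm
      rw [Finset.mem_erase, not_and_or, not_not] at hv
      rcases hv with rfl | hv
      · rw [sub_self, mul_zero]
      · have h2 : f v x = 0 := by simpa [hT] using hv
        have h3 : f v y = 0 := by
          rw [hTxy] at hv
          simpa [hT] using hv
        rw [h2, h3, sub_zero, zero_mul]
    rw [Real.dist_eq, hdiff]
    calc _ ≤ ∑ v ∈ (T x).erase t₀, |(f v x - f v y) * (ρ.d (p v) (p w) - ρ.d (p t₀) (p w))| :=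
          Finset.abs_sum_le_sum_abs _ _
      _ ≤ ∑ v ∈ (T x).erase t₀, 1 / q * B := by
          refine Finset.sum_le_sum fun v hv => ?_
          rw [abs_mul]
          refine mul_le_mul (hclose v hv) ?_ (abs_nonneg _) (by positivity)
          have h1 := hB (p v) (p w)
          have h2 := hB (p t₀) (p w)
          have h3 := ρ.nonneg (p v) (p w)
          have h4 := ρ.nonneg (p t₀) (p w)
          rw [abs_le]
          constructor <;> linarith
      _ = ((T x).erase t₀).card * (1 / q * B) := by rw [Finset.sum_const, nsmul_eq_mul]
      _ ≤ n * (1 / q * B) := by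
          gcongr
          rw [Finset.card_erase_of_mem (he1 _ _)]
          have := hTcard x
          omega
      _ ≤ (n * B + 1) / q := by
          rw [le_div_iff₀ hq']
          field_simp
          linarith

/-- The continuous pseudometrics on `Z`, as a subset of `C(Z × Z, ℝ)`. -/
def pseudometricSet (Z : Type*) [TopologicalSpace Z] : Set C(Z × Z, ℝ) :=
  {f | (∀ x, f (x, x) = 0) ∧ (∀ x y, f (x, y) = f (y, x)) ∧
    ∀ x y z, f (x, z) ≤ f (x, y) + f (y, z)}

lemma isClosed_pseudometricSet (Z : Type*) [TopologicalSpace Z] :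
    IsClosed (pseudometricSet Z) := by
  have hev : ∀ p : Z × Z, Continuous fun f : C(Z × Z, ℝ) => f p := fun p =>
    continuous_eval_const p
  have heq : pseudometricSet Z = (⋂ x, {f : C(Z × Z, ℝ) | f (x, x) = 0}) ∩
      ((⋂ x, ⋂ y, {f : C(Z × Z, ℝ) | f (x, y) = f (y, x)}) ∩
        ⋂ x, ⋂ y, ⋂ z, {f : C(Z × Z, ℝ) | f (x, z) ≤ f (x, y) + f (y, z)}) := by
    ext f
    simp [pseudometricSet]
  rw [heq]
  refine (isClosed_iInter fun x => isClosed_eq (hev _) continuous_const).inter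
    ((isClosed_iInter fun x => isClosed_iInter fun y => isClosed_eq (hev _) (hev _)).inter
      (isClosed_iInter fun x => isClosed_iInter fun y => isClosed_iInter fun z =>
        isClosed_le (hev _) ((hev _).add (hev _))))

/-- The continuous pseudometric given by an element of `pseudometricSet Z`. -/
def ContPseudoMetric.ofPseudometricSet {Z : Type*} [TopologicalSpace Z]
    (f : pseudometricSet Z) : ContPseudoMetric Z where
  d x y := f.1 (x, y)
  continuous' := f.1.continuous
  nonneg x y := by
    have h := f.2.2.2 x y x
    rw [f.2.1 x, f.2.2.1 y x] at h
    linarith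
  symm := f.2.2.1
  refl := f.2.1
  triangle := f.2.2.2

/-- A continuous pseudometric as an element of `pseudometricSet Z`. -/
def ContPseudoMetric.toPseudometricSet {Z : Type*} [TopologicalSpace Z]
    (ρ : ContPseudoMetric Z) : pseudometricSet Z :=
  ⟨⟨fun p => ρ.d p.1 p.2, ρ.continuous'⟩, ρ.refl, ρ.symm, ρ.triangle⟩

/-- `f` admits a partition of `Z` with few pieces of small diameter: at some scale `ε < κ` the
number of pieces is at most `ε⁻¹` to the power `n + κ`. -/
def HasGoodCells {Z : Type*} (n : ℕ) (κ : ℝ) (f : Z × Z → ℝ) : Prop :=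
  ∃ ε ε' : ℝ, 0 < ε ∧ ε < κ ∧ ε' < ε ∧ ∃ (M : ℕ) (cell : Z → Fin M),
    (∀ x y, cell x = cell y → f (x, y) ≤ ε') ∧ Real.log M ≤ (n + κ) * |Real.log ε|

lemma isOpen_hasGoodCells {Z : Type*} [TopologicalSpace Z] [CompactSpace Z] (n : ℕ) (κ : ℝ) :
    IsOpen {f : C(Z × Z, ℝ) | HasGoodCells n κ f} := by
  refine Metric.isOpen_iff.2 fun f hf => ?_
  obtain ⟨ε, ε', h0, h1, h2, M, cell, h3, h4⟩ := hf
  refine ⟨(ε - ε') / 2, by linarith, fun g hg => ?_⟩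
  refine ⟨ε, (ε + ε') / 2, h0, h1, by linarith, M, cell, fun x y hxy => ?_, h4⟩
  have h5 := (ContinuousMap.dist_apply_le_dist (f := g) (g := f) (x, y)).trans_lt hg
  have h6 := (abs_lt.1 (Real.dist_eq _ _ ▸ h5)).2
  linarith [h3 x y hxy]

lemma exists_scale {N : ℕ} {D κ : ℝ} (hN : 0 < N) (hD : 0 < D) (hκ : 0 < κ) (n : ℕ) :
    ∃ q : ℕ, 0 < q ∧ 2 * D / q < κ ∧
      Real.log ((N * (q + 1) ^ n : ℕ) : ℝ) ≤ (n + κ) * |Real.log (2 * D / q)| := by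
  have hlog : Tendsto (fun q : ℕ => Real.log q) atTop atTop :=
    Real.tendsto_log_atTop.comp tendsto_natCast_atTop_atTop
  have hdiv : Tendsto (fun q : ℕ => 2 * D / (q : ℝ)) atTop (𝓝 0) :=
    tendsto_const_div_atTop_nhds_zero_nat _
  obtain ⟨q, hq, hqκ, hqlog⟩ := ((eventually_gt_atTop 0).and ((hdiv.eventually_lt_const hκ).and
    (hlog.eventually_ge_atTop
      ((Real.log N + n * Real.log 2 + (n + κ) * Real.log (2 * D)) / κ)))).exists
  have hq' : (0 : ℝ) < q := by exact_mod_cast hq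
  have hN' : (0 : ℝ) < N := by exact_mod_cast hN
  refine ⟨q, hq, hqκ, ?_⟩
  rw [div_le_iff₀ hκ] at hqlog
  have h1 : Real.log ((q : ℝ) + 1) ≤ Real.log 2 + Real.log q := by
    rw [← Real.log_mul two_ne_zero hq'.ne']
    refine Real.log_le_log (by positivity) ?_
    have : (1 : ℝ) ≤ q := by exact_mod_cast hq
    linarith
  have h2 : Real.log q - Real.log (2 * D) ≤ |Real.log (2 * D / q)| := by
    rw [Real.log_div (by positivity) hq'.ne', ← neg_sub]
    exact neg_le_abs _
  push_cast
  rw [Real.log_mul hN'.ne' (by positivity), Real.log_pow]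
  have h3 : (n : ℝ) * Real.log ((q : ℝ) + 1) ≤ n * (Real.log 2 + Real.log q) := by gcongr
  have h4 : (n + κ) * (Real.log q - Real.log (2 * D)) ≤ (n + κ) * |Real.log (2 * D / q)| := by
    gcongr
  nlinarith

lemma dense_hasGoodCells {Z : Type*} [TopologicalSpace Z] [CompactSpace Z] [T2Space Z] {n : ℕ}
    (hn : covDim Z = n) {κ : ℝ} (hκ : 0 < κ) :
    Dense {f : pseudometricSet Z | HasGoodCells n κ f.1} := by
  refine Metric.dense_iff.2 fun f r hr => ?_
  obtain ⟨ρ', hclose, N, D, hD, hN, hcell⟩ :=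
    (ContPseudoMetric.ofPseudometricSet f).exists_approx_cells hn (η := r / 8) (by positivity)
  refine ⟨ρ'.toPseudometricSet, ?_, ?_⟩
  · refine lt_of_le_of_lt ((ContinuousMap.dist_le (C := r / 2) (by positivity)).2 fun p => ?_)
      (half_lt_self hr)
    rw [Real.dist_eq]
    exact (hclose p.1 p.2).trans (by linarith)
  · obtain ⟨q, hq, h1, h2⟩ := exists_scale hN hD hκ n
    have hq' : (0 : ℝ) < q := by exact_mod_cast hq
    obtain ⟨cell, h3⟩ := hcell q hq
    exact ⟨2 * D / q, D / q, by positivity, h1, by gcongr; linarith, _, cell, h3, h2⟩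

/-- A generic continuous pseudometric separates points at a prescribed scale. -/
lemma isOpen_dense_separating {Z : Type*} [TopologicalSpace Z] [CompactSpace Z]
    (ρ : ContPseudoMetric Z) {κ : ℝ} (hκ : 0 < κ) :
    IsOpen {f : pseudometricSet Z | ∀ x y, κ ≤ ρ.d x y → 0 < f.1 (x, y)} ∧
      Dense {f : pseudometricSet Z | ∀ x y, κ ≤ ρ.d x y → 0 < f.1 (x, y)} := by
  constructor
  · have hK : IsCompact {p : Z × Z | κ ≤ ρ.d p.1 p.2} :=
      (isClosed_le continuous_const ρ.continuous').isCompact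
    have := (ContinuousMap.isOpen_setOfPred_mapsTo hK (isOpen_Ioi (a := (0 : ℝ)))).preimage
      (continuous_subtype_val (p := (· ∈ pseudometricSet Z)))
    convert this using 1
    ext f
    simp [Set.MapsTo]
  · obtain ⟨B, hB, hbound⟩ := ρ.exists_bound
    refine Metric.dense_iff.2 fun f r hr => ?_
    have ht : 0 < r / (2 * B) := by positivity
    let g : ContPseudoMetric Z :=
      { d := fun x y => f.1 (x, y) + r / (2 * B) * ρ.d x y
        continuous' := f.1.continuous.add (continuous_const.mul ρ.continuous')
        nonneg := fun x y => add_nonneg ((ContPseudoMetric.ofPseudometricSet f).nonneg x y)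
          (mul_nonneg ht.le (ρ.nonneg x y))
        symm := fun x y => by rw [ρ.symm x y, f.2.2.1 x y]
        refl := fun x => by rw [ρ.refl, f.2.1 x, mul_zero, add_zero]
        triangle := fun x y z => by
          have h1 := f.2.2.2 x y z
          have h2 := mul_le_mul_of_nonneg_left (ρ.triangle x y z) ht.le
          linarith }
    refine ⟨g.toPseudometricSet, ?_, fun x y hxy => ?_⟩
    · refine lt_of_le_of_lt ((ContinuousMap.dist_le (C := r / 2) (by positivity)).2 fun p => ?_)
        (half_lt_self hr)
      have h1 : r / (2 * B) * ρ.d p.1 p.2 ≤ r / 2 := by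
        calc r / (2 * B) * ρ.d p.1 p.2 ≤ r / (2 * B) * B := by gcongr; exact hbound _ _
          _ = r / 2 := by field_simp
      have h2 : 0 ≤ r / (2 * B) * ρ.d p.1 p.2 := mul_nonneg ht.le (ρ.nonneg _ _)
      rw [Real.dist_eq]
      change |f.1 (p.1, p.2) + r / (2 * B) * ρ.d p.1 p.2 - f.1 p| ≤ r / 2
      rw [add_sub_cancel_left, abs_of_nonneg h2]
      exact h1
    · exact add_pos_of_nonneg_of_pos ((ContPseudoMetric.ofPseudometricSet f).nonneg x y)
        (mul_pos ht (hκ.trans_le hxy))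

lemma exists_isCompatMetric (Z : Type*) [TopologicalSpace Z] [MetrizableSpace Z] :
    ∃ ρ : ContPseudoMetric Z, ρ.IsCompatMetric := by
  let _ := metrizableSpaceMetric Z
  exact ⟨⟨dist, continuous_dist, fun _ _ => dist_nonneg, dist_comm, dist_self, dist_triangle⟩,
    fun _ _ h => dist_eq_zero.1 h⟩

/-- A compact metrizable space of covering dimension `n` has a compatible metric whose lower
box dimension is at most `n`. -/
theorem exists_isCompatMetric_cells {Z : Type*} [TopologicalSpace Z] [CompactSpace Z]
    [MetrizableSpace Z] {n : ℕ} (hn : covDim Z = n) :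
    ∃ ρ : ContPseudoMetric Z, ρ.IsCompatMetric ∧ ∀ κ : ℝ, 0 < κ → ∃ ε : ℝ, 0 < ε ∧ ε < κ ∧
      ∃ (M : ℕ) (cell : Z → Fin M), (∀ x y, cell x = cell y → ρ.d x y ≤ ε) ∧
        Real.log M ≤ (n + κ) * |Real.log ε| := by
  obtain ⟨ρ₀, hρ₀⟩ := exists_isCompatMetric Z
  have : CompleteSpace (pseudometricSet Z) := (isClosed_pseudometricSet Z).completeSpace_coe
  have hpos : ∀ k : ℕ, (0 : ℝ) < 1 / (k + 1) := fun k => by positivity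
  have hd := dense_iInter_of_isOpen_nat (X := pseudometricSet Z)
    (f := fun k : ℕ => {f : pseudometricSet Z | HasGoodCells n (1 / (k + 1)) f.1} ∩
      {f : pseudometricSet Z | ∀ x y, 1 / ((k : ℝ) + 1) ≤ ρ₀.d x y → 0 < f.1 (x, y)})
    (fun k => ((isOpen_hasGoodCells n _).preimage continuous_subtype_val).inter
      (isOpen_dense_separating ρ₀ (hpos k)).1)
    (fun k => (dense_hasGoodCells hn (hpos k)).inter_of_isOpen_right
      (isOpen_dense_separating ρ₀ (hpos k)).2 (isOpen_dense_separating ρ₀ (hpos k)).1)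
  have : Nonempty (pseudometricSet Z) := ⟨ρ₀.toPseudometricSet⟩
  obtain ⟨f, hf⟩ := hd.nonempty
  rw [Set.mem_iInter] at hf
  refine ⟨ContPseudoMetric.ofPseudometricSet f, fun x y hxy => ?_, fun κ hκ => ?_⟩
  · by_contra hne
    have h1 : 0 < ρ₀.d x y := lt_of_le_of_ne (ρ₀.nonneg x y) fun h => hne (hρ₀ x y h.symm)
    obtain ⟨k, hk⟩ := exists_nat_one_div_lt h1
    exact ((hf k).2 x y hk.le).ne' hxy
  · obtain ⟨k, hk⟩ := exists_nat_one_div_lt hκ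
    obtain ⟨ε, ε', h0, h1, h2, M, cell, h3, h4⟩ := (hf k).1
    exact ⟨ε, h0, h1.trans hk, M, cell, fun x y hxy => (h3 x y hxy).trans h2.le,
      h4.trans (by gcongr)⟩

lemma ContPseudoMetric.summable_pi {ι Z : Type*} [TopologicalSpace Z] [CompactSpace Z]
    (ρ : ContPseudoMetric Z) {w : ι → ℝ} (hw : ∀ i, 0 < w i) (hs : Summable w) (x y : ι → Z) :
    Summable fun i => w i * ρ.d (x i) (y i) := by
  obtain ⟨B, -, hB⟩ := ρ.exists_bound
  exact Summable.of_nonneg_of_le (fun i => mul_nonneg (hw i).le (ρ.nonneg _ _))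
    (fun i => mul_le_mul_of_nonneg_left (hB _ _) (hw i).le) (hs.mul_right B)

/-- The weighted sum of copies of a continuous pseudometric on a product space. -/
noncomputable def ContPseudoMetric.pi {ι Z : Type*} [TopologicalSpace Z] [CompactSpace Z]
    (ρ : ContPseudoMetric Z) {w : ι → ℝ} (hw : ∀ i, 0 < w i) (hs : Summable w) :
    ContPseudoMetric (ι → Z) where
  d x y := ∑' i, w i * ρ.d (x i) (y i)
  continuous' := by
    obtain ⟨B, -, hB⟩ := ρ.exists_bound
    have hcont : ∀ i, Continuous fun p : (ι → Z) × (ι → Z) => w i * ρ.d (p.1 i) (p.2 i) := fun i =>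
      continuous_const.mul (ρ.continuous'.comp (f := fun p : (ι → Z) × (ι → Z) => (p.1 i, p.2 i))
        (by fun_prop))
    refine continuous_tsum hcont (hs.mul_right B) fun i p => ?_
    rw [Real.norm_of_nonneg (mul_nonneg (hw i).le (ρ.nonneg _ _))]
    exact mul_le_mul_of_nonneg_left (hB _ _) (hw i).le
  nonneg x y := tsum_nonneg fun i => mul_nonneg (hw i).le (ρ.nonneg _ _)
  symm x y := by simp_rw [ρ.symm (x _)]
  refl x := by simp [ρ.refl]
  triangle x y z := by
    rw [← (ρ.summable_pi hw hs x y).tsum_add (ρ.summable_pi hw hs y z)]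
    refine (ρ.summable_pi hw hs x z).tsum_le_tsum (fun i => ?_)
      ((ρ.summable_pi hw hs x y).add (ρ.summable_pi hw hs y z))
    rw [← mul_add]
    exact mul_le_mul_of_nonneg_left (ρ.triangle _ _ _) (hw i).le

lemma ContPseudoMetric.mul_le_pi {ι Z : Type*} [TopologicalSpace Z] [CompactSpace Z]
    (ρ : ContPseudoMetric Z) {w : ι → ℝ} (hw : ∀ i, 0 < w i) (hs : Summable w) (i : ι)
    (x y : ι → Z) : w i * ρ.d (x i) (y i) ≤ (ρ.pi hw hs).d x y :=
  (ρ.summable_pi hw hs x y).le_tsum i fun j _ => mul_nonneg (hw j).le (ρ.nonneg _ _)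

lemma ContPseudoMetric.IsCompatMetric.pi {ι Z : Type*} [TopologicalSpace Z] [CompactSpace Z]
    {ρ : ContPseudoMetric Z} (hρ : ρ.IsCompatMetric) {w : ι → ℝ} (hw : ∀ i, 0 < w i)
    (hs : Summable w) : (ρ.pi hw hs).IsCompatMetric := by
  refine fun x y hxy => funext fun i => hρ _ _ (le_antisymm ?_ (ρ.nonneg _ _))
  have h := ρ.mul_le_pi hw hs i x y
  rw [hxy] at h
  exact nonpos_of_mul_nonpos_right h (hw i)

lemma ContPseudoMetric.exists_finset_pi_le {ι Z : Type*} [TopologicalSpace Z] [CompactSpace Z]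
    (ρ : ContPseudoMetric Z) {w : ι → ℝ} (hw : ∀ i, 0 < w i) (hs : Summable w) {η : ℝ}
    (hη : 0 < η) : ∃ J : Finset ι, ∀ c, 0 ≤ c → ∀ x y : ι → Z, (∀ t ∈ J, ρ.d (x t) (y t) ≤ c) →
      (ρ.pi hw hs).d x y ≤ (∑' i, w i) * c + η := by
  obtain ⟨B, hB0, hB⟩ := ρ.exists_bound
  have hlt : ∑' i, w i - η / B < ∑' i, w i := sub_lt_self _ (by positivity)
  obtain ⟨J, hJ⟩ := (hs.hasSum.eventually_const_lt hlt).exists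
  refine ⟨J, fun c hc x y hxy => ?_⟩
  have hJsum : HasSum (fun i => if i ∈ J then w i else 0) (∑ i ∈ J, w i) := by
    have : HasSum (fun i => if i ∈ J then w i else 0) (∑ i ∈ J, if i ∈ J then w i else 0) :=
      hasSum_sum_of_ne_finset_zero fun i hi => if_neg hi
    rwa [Finset.sum_congr rfl fun i hi => if_pos hi] at this
  have hmaj := (hs.hasSum.mul_right c).add ((hs.hasSum.sub hJsum).mul_right B)
  refine (hasSum_le (fun i => ?_) (ρ.summable_pi hw hs x y).hasSum hmaj).trans ?_
  · by_cases hi : i ∈ J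
    · simpa [hi] using mul_le_mul_of_nonneg_left (hxy i hi) (hw i).le
    · have h1 := mul_le_mul_of_nonneg_left (hB (x i) (y i)) (hw i).le
      have h2 := mul_nonneg (hw i).le hc
      simp only [hi, if_false, sub_zero]
      linarith
  · have h1 : (∑' i, w i - ∑ i ∈ J, w i) * B ≤ η := by
      rw [← le_div_iff₀ hB0]
      linarith
    linarith

lemma sepNum_le_card {Y α : Type*} [Fintype α] {r : Y → Y → ℝ} {ε : ℝ} (code : Y → α)
    (h : ∀ x y, code x = code y → r x y < ε) : sepNum r ε ≤ Fintype.card α := by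
  refine iSup₂_le fun E hE => ?_
  have hinj : Set.InjOn code E := fun x hx y hy hxy => by
    by_contra hne
    exact (h x y hxy).not_ge (hE x hx y hy hne)
  rw [← hinj.encard_image, ← ENat.card_eq_coe_fintype_card, ← Set.encard_univ]
  exact Set.encard_le_encard (Set.subset_univ _)

lemma elog_le_log {m : ℕ∞} {K : ℕ} (h : m ≤ K) : elog m ≤ ((Real.log K : ℝ) : EReal) := by
  have htop : m ≠ ⊤ := (h.trans_lt (ENat.natCast_lt_top K)).ne
  rw [elog, if_neg htop]
  split_ifs with h0
  · exact bot_le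
  · lift m to ℕ using htop
    have h0' : 0 < m := Nat.pos_of_ne_zero (by exact_mod_cast h0)
    refine EReal.coe_le_coe_iff.2 (Real.log_le_log (by simpa using h0') ?_)
    simpa using h

/-- Approximately equivariant maps into the shift are determined, up to a small error, by their
coordinate at the identity and their behaviour on a small set of exceptional points. -/
lemma sepNum_mapSpace_le {G Z : Type*} [Group G] [TopologicalSpace Z] {ρ : ContPseudoMetric Z}
    {τ : ContPseudoMetric (G → Z)} {w : ℝ} (hw : 0 < w)
    (hτ : ∀ x y : G → Z, w * ρ.d (x 1) (y 1) ≤ τ.d x y) {J : Finset G} {ε η : ℝ} (hε : 0 < ε)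
    (hJ : ∀ x y : G → Z, (∀ t ∈ J, ρ.d (x t) (y t) ≤ 3 * ε) → τ.d x y < η) {M : ℕ}
    {cell : Z → Fin M} (hcell : ∀ x y, cell x = cell y → ρ.d x y ≤ ε) {F : Finset G}
    (hF : ∀ t ∈ J, t⁻¹ ∈ F) {δ : ℝ} {d : ℕ} (hd : 0 < d) (σ : G → Equiv.Perm (Fin d)) {b : ℕ}
    (hb : J.card * (d * δ ^ 2 / (w * ε) ^ 2) < b + 1) :
    sepNum (fun φ ψ : MapSpace τ F δ σ => rhoInfty τ φ.1 ψ.1) η ≤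
      (M ^ d * (2 ^ d * M ^ (J.card * b)) : ℕ) := by
  have : Nonempty (Fin d) := ⟨⟨0, hd⟩⟩
  have hd' : (0 : ℝ) < d := by exact_mod_cast hd
  set bad : (Fin d → G → Z) → Finset (Fin d) := fun φ => J.biUnion fun t =>
    Finset.univ.filter fun a => ε < ρ.d (φ (σ t⁻¹ a) 1) (φ a t) with hbad
  have hcard : ∀ φ ∈ MapSpace τ F δ σ, (bad φ).card ≤ b := by
    intro φ hφ
    have hone : ∀ t ∈ J, ((Finset.univ.filter fun a => ε < ρ.d (φ (σ t⁻¹ a) 1) (φ a t)).card : ℝ) ≤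
        d * δ ^ 2 / (w * ε) ^ 2 := by
      intro t ht
      have h1 := (Real.sqrt_le_iff.1 (hφ t⁻¹ (hF t ht))).2
      rw [one_div, inv_mul_le_iff₀ hd'] at h1
      rw [le_div_iff₀ (by positivity)]
      refine le_trans ?_ h1
      rw [← nsmul_eq_mul, ← Finset.sum_const]
      refine (Finset.sum_le_sum fun a ha => ?_).trans
        (Finset.sum_le_sum_of_subset_of_nonneg (Finset.filter_subset _ _)
          fun a _ _ => sq_nonneg _)
      have h2 := hτ (φ (σ t⁻¹ a)) (t⁻¹ • φ a)
      have h3 : (t⁻¹ • φ a) 1 = φ a t := by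
        change φ a (t⁻¹⁻¹ * 1) = φ a t
        rw [inv_inv, mul_one]
      rw [h3] at h2
      have h4 := (Finset.mem_filter.1 ha).2
      gcongr
      exact (mul_le_mul_of_nonneg_left h4.le hw.le).trans h2
    have h5 : ((bad φ).card : ℝ) < b + 1 := by
      refine lt_of_le_of_lt ?_ hb
      refine (Nat.cast_le.2 Finset.card_biUnion_le).trans ?_
      rw [Nat.cast_sum, ← nsmul_eq_mul]
      exact Finset.sum_le_card_nsmul _ _ _ hone
    exact Nat.lt_succ_iff.1 (by exact_mod_cast h5)
  have henum : ∀ S : Finset (Fin d), ∃ e : Fin b → Fin d, S.card ≤ b → ∀ a ∈ S, ∃ k, e k = a := by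
    intro S
    by_cases hS : S.card ≤ b
    · obtain ⟨e, he⟩ := exists_fin_enumeration S hS
      exact ⟨e, fun _ => he⟩
    · exact ⟨fun _ => ⟨0, hd⟩, fun h => absurd h hS⟩
  choose e he using henum
  let code : MapSpace τ F δ σ → (Fin d → Fin M) × (Finset (Fin d) × (J × Fin b → Fin M)) :=
    fun φ => (fun a => cell (φ.1 a 1), bad φ.1, fun p => cell (φ.1 (e (bad φ.1) p.2) p.1))
  refine (sepNum_le_card code fun φ ψ hφψ => ?_).trans (le_of_eq (by simp))
  have hcell1 : ∀ a, cell (φ.1 a 1) = cell (ψ.1 a 1) := congrFun (congrArg Prod.fst hφψ)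
  have hbadeq : bad φ.1 = bad ψ.1 := congrArg (fun p => p.2.1) hφψ
  have hcell2 : ∀ p : J × Fin b, cell (φ.1 (e (bad φ.1) p.2) p.1) =
      cell (ψ.1 (e (bad ψ.1) p.2) p.1) := congrFun (congrArg (fun p => p.2.2) hφψ)
  obtain ⟨a, ha⟩ := exists_eq_ciSup_of_finite (f := fun a => τ.d (φ.1 a) (ψ.1 a))
  rw [rhoInfty, ← ha]
  refine hJ _ _ fun t ht => ?_
  by_cases hab : a ∈ bad φ.1
  · obtain ⟨k, hk⟩ := he _ (hcard φ.1 φ.2) a hab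
    have h1 := hcell2 (⟨t, ht⟩, k)
    rw [← hbadeq, hk] at h1
    linarith [hcell _ _ h1]
  · have hgood : ∀ χ : Fin d → G → Z, a ∉ bad χ → ρ.d (χ (σ t⁻¹ a) 1) (χ a t) ≤ ε := by
      intro χ hχ
      by_contra! hlt
      exact hχ (Finset.mem_biUnion.2 ⟨t, ht, Finset.mem_filter.2 ⟨Finset.mem_univ _, hlt⟩⟩)
    have h1 := hgood φ.1 hab
    have h2 := hgood ψ.1 (hbadeq ▸ hab)
    have h3 := hcell _ _ (hcell1 (σ t⁻¹ a))
    have h4 := ρ.triangle (φ.1 a t) (φ.1 (σ t⁻¹ a) 1) (ψ.1 a t)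
    have h5 := ρ.triangle (φ.1 (σ t⁻¹ a) 1) (ψ.1 (σ t⁻¹ a) 1) (ψ.1 a t)
    rw [ρ.symm (φ.1 a t) (φ.1 (σ t⁻¹ a) 1)] at h4
    linarith

lemma hEps_le {G Z : Type*} [Group G] [TopologicalSpace Z] (Sap : SoficApprox G)
    {ρ : ContPseudoMetric Z} {τ : ContPseudoMetric (G → Z)} {w : ℝ} (hw : 0 < w)
    (hτ : ∀ x y : G → Z, w * ρ.d (x 1) (y 1) ≤ τ.d x y) {J : Finset G} {ε η : ℝ} (hε : 0 < ε)
    (hJ : ∀ x y : G → Z, (∀ t ∈ J, ρ.d (x t) (y t) ≤ 3 * ε) → τ.d x y < η) {M : ℕ}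
    {cell : Z → Fin M} (hcell : ∀ x y, cell x = cell y → ρ.d x y ≤ ε) {κ : ℝ} (hκ : 0 < κ) :
    hEps Sap τ η ≤ (((1 + κ) * Real.log M + Real.log 2 : ℝ) : EReal) := by
  set β : ℝ := κ / (J.card + 1) with hβ
  have hβ0 : 0 < β := by positivity
  set δ : ℝ := Real.sqrt (β * (w * ε) ^ 2 / (J.card + 1)) with hδ
  have hδ0 : 0 < δ := Real.sqrt_pos.2 (by positivity)
  have hδ2 : δ ^ 2 = β * (w * ε) ^ 2 / (J.card + 1) := Real.sq_sqrt (by positivity)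
  have hJβ : J.card * β ≤ κ := by
    rw [hβ, mul_div_assoc', div_le_iff₀ (by positivity)]
    nlinarith
  refine (iInf_le _ ⟨insert 1 (J.image (·⁻¹)), Finset.insert_nonempty _ _⟩).trans
    ((iInf_le _ ⟨δ, hδ0⟩).trans (limsup_le_of_le (by isBoundedDefault) ?_))
  filter_upwards [Sap.eventually_pos] with i hd
  have hd' : (0 : ℝ) < Sap.d i := by exact_mod_cast hd
  have hb : J.card * (Sap.d i * δ ^ 2 / (w * ε) ^ 2) < ⌊β * Sap.d i⌋₊ + 1 := by
    refine lt_of_le_of_lt ?_ (Nat.lt_floor_add_one _)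
    have : (J.card : ℝ) * (Sap.d i * δ ^ 2 / (w * ε) ^ 2) =
        J.card * (β * Sap.d i) / (J.card + 1) := by
      rw [hδ2]
      field_simp
    rw [this, div_le_iff₀ (by positivity)]
    have : 0 < β * Sap.d i := by positivity
    nlinarith
  have hsep := elog_le_log (sepNum_mapSpace_le hw hτ hε hJ hcell
    (F := insert 1 (J.image (·⁻¹)))
    (fun t ht => Finset.mem_insert_of_mem (Finset.mem_image_of_mem _ ht)) hd (Sap.σ i) hb)
  have hlogM : 0 ≤ Real.log M := Real.log_natCast_nonneg M
  have hlog2 : 0 < Real.log 2 := Real.log_pos one_lt_two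
  have hlog : Real.log ((M ^ Sap.d i * (2 ^ Sap.d i * M ^ (J.card * ⌊β * Sap.d i⌋₊)) : ℕ) : ℝ) ≤
      ((1 + κ) * Real.log M + Real.log 2) * Sap.d i := by
    rcases Nat.eq_zero_or_pos M with rfl | hM
    · rw [zero_pow hd.ne', zero_mul, Nat.cast_zero, Real.log_zero, mul_zero, zero_add]
      positivity
    · have hM' : (0 : ℝ) < M := by exact_mod_cast hM
      push_cast
      rw [Real.log_mul (by positivity) (by positivity), Real.log_mul (by positivity)
        (by positivity), Real.log_pow, Real.log_pow, Real.log_pow]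
      push_cast
      have h1 := Nat.floor_le (a := β * Sap.d i) (by positivity)
      have h2 : (J.card : ℝ) * ⌊β * Sap.d i⌋₊ ≤ κ * Sap.d i := by
        calc (J.card : ℝ) * ⌊β * Sap.d i⌋₊ ≤ J.card * (β * Sap.d i) := by gcongr
          _ = J.card * β * Sap.d i := by ring
          _ ≤ κ * Sap.d i := by gcongr
      nlinarith
  refine (mul_le_mul_of_nonneg_right (hsep.trans (EReal.coe_le_coe_iff.2 hlog))
    (by exact_mod_cast (inv_pos.2 hd').le :
      (0 : EReal) ≤ (((Sap.d i : ℝ)⁻¹ : ℝ) : EReal))).trans (le_of_eq ?_)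
  rw [← EReal.coe_mul, mul_inv_cancel_right₀ hd'.ne']

theorem mdimSigmaM_pi_le {G Z : Type*} [Group G] [TopologicalSpace Z] [CompactSpace Z]
    (Sap : SoficApprox G) {ρ : ContPseudoMetric Z} {w : G → ℝ} (hw : ∀ g, 0 < w g)
    (hs : Summable w) {n : ℕ}
    (hρ : ∀ κ : ℝ, 0 < κ → ∃ ε : ℝ, 0 < ε ∧ ε < κ ∧
      ∃ (M : ℕ) (cell : Z → Fin M), (∀ x y, cell x = cell y → ρ.d x y ≤ ε) ∧
        Real.log M ≤ (n + κ) * |Real.log ε|) :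
    mdimSigmaM Sap (ρ.pi hw hs) ≤ ((n : ℝ) : EReal) := by
  refine EReal.le_of_forall_lt_iff_le.1 fun c hc => ?_
  have hc : (n : ℝ) < c := by exact_mod_cast hc
  refine liminf_le_of_frequently_le' ((nhdsGT_basis (0 : ℝ)).frequently_iff.2 fun u hu => ?_)
  set W := ∑' g, w g with hW
  have hW0 : 0 ≤ W := tsum_nonneg fun g => (hw g).le
  set A := 3 * W + 2 with hA
  have hA0 : 0 < A := by positivity
  set m : ℝ := (n + c) / 2 with hm
  have hmc : 0 < c - m := by linarith
  have hlim : Tendsto (fun κ : ℝ => (1 + κ) * (n + κ)) (𝓝[>] 0) (𝓝 n) := by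
    have : Continuous fun κ : ℝ => (1 + κ) * (n + κ) := by fun_prop
    simpa using (this.tendsto 0).mono_left nhdsWithin_le_nhds
  have hlog : Tendsto (fun κ : ℝ => -Real.log κ) (𝓝[>] 0) atTop :=
    tendsto_neg_atBot_atTop.comp Real.tendsto_log_nhdsGT_zero
  obtain ⟨κ, hκm, hκ1, hκ2, hκ3, hκu, hκ0⟩ := ((hlim.eventually_lt_const
    (show (n : ℝ) < m by linarith)).and ((hlog.eventually_gt_atTop 0).and
    ((hlog.eventually_gt_atTop (Real.log A)).and
    ((hlog.eventually_ge_atTop ((Real.log 2 + c * Real.log A) / (c - m))).and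
    ((eventually_nhdsWithin_of_eventually_nhds (eventually_lt_nhds
      (show (0 : ℝ) < u / A by positivity))).and self_mem_nhdsWithin))))).exists
  have hκ0 : 0 < κ := hκ0
  obtain ⟨ε, hε0, hεκ, M, cell, hcell, hM⟩ := hρ κ hκ0
  have hεlog : Real.log ε ≤ Real.log κ := Real.log_le_log hε0 hεκ.le
  rw [abs_of_neg (by linarith)] at hM
  obtain ⟨J, hJ⟩ := ρ.exists_finset_pi_le hw hs hε0
  have hle : hEps Sap (ρ.pi hw hs) (A * ε) ≤ (((1 + κ) * Real.log M + Real.log 2 : ℝ) : EReal) :=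
    hEps_le Sap (hw 1) (ρ.mul_le_pi hw hs 1) hε0 (fun x y hxy =>
      (hJ _ (by positivity) x y hxy).trans_lt (by rw [← hW, hA]; nlinarith)) hcell hκ0
  refine ⟨A * ε, ⟨by positivity, ?_⟩, ?_⟩
  · calc A * ε < A * (u / A) := by gcongr; exact hεκ.trans hκu
      _ = u := by field_simp
  · have habs : |Real.log (A * ε)| = -Real.log ε - Real.log A := by
      rw [Real.log_mul hA0.ne' hε0.ne', abs_of_neg (by linarith)]
      ring
    have hpos : 0 < -Real.log ε - Real.log A := by linarith
    refine (mul_le_mul_of_nonneg_right hle (by exact_mod_cast (inv_pos.2 (habs ▸ hpos)).le)).trans ?_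
    rw [habs, ← EReal.coe_mul, EReal.coe_le_coe_iff, ← div_eq_mul_inv, div_le_iff₀ hpos]
    rw [div_le_iff₀ hmc] at hκ3
    have h1 : (1 + κ) * Real.log M ≤ m * -Real.log ε := by
      calc (1 + κ) * Real.log M ≤ (1 + κ) * ((n + κ) * -Real.log ε) := by gcongr
        _ = (1 + κ) * (n + κ) * -Real.log ε := by ring
        _ ≤ m * -Real.log ε := by
          refine mul_le_mul_of_nonneg_right hκm.le (by linarith)
    nlinarith

theorem mdimSigmaMFull_le_covDim {G : Type*} [Group G] [Countable G] (Sap : SoficApprox G)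
    (Z : Type*) [TopologicalSpace Z] [CompactSpace Z] [MetrizableSpace Z] :
    mdimSigmaMFull Sap (G → Z) ≤ enatToEReal (covDim Z) := by
  by_cases htop : covDim Z = ⊤
  · rw [enatToEReal, if_pos htop]
    exact le_top
  · obtain ⟨n, hn⟩ := ENat.ne_top_iff_exists.1 htop
    obtain ⟨ρ, hρ, hcells⟩ := exists_isCompatMetric_cells hn.symm
    let _ := Encodable.ofCountable G
    have hw : ∀ g : G, (0 : ℝ) < (1 / 2) ^ Encodable.encode g := fun g => by positivity
    have hs : Summable fun g : G => ((1 : ℝ) / 2) ^ Encodable.encode g :=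
      summable_geometric_two_encode
    have hdim : enatToEReal (covDim Z) = ((n : ℝ) : EReal) := by simp [enatToEReal, ← hn]
    rw [hdim]
    exact (iInf_le (fun ρ : {ρ : ContPseudoMetric (G → Z) // ρ.IsCompatMetric} =>
      mdimSigmaM Sap ρ.1) ⟨ρ.pi hw hs, hρ.pi hw hs⟩).trans (mdimSigmaM_pi_le Sap hw hs hcells)

lemma enatToEReal_le_of_forall {m : ℕ∞} {r : EReal}
    (h : ∀ n : ℕ, (n : ℕ∞) ≤ m → ((n : ℝ) : EReal) ≤ r) : enatToEReal m ≤ r := by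
  by_cases htop : m = ⊤
  · subst htop
    have hr : r = ⊤ := EReal.eq_top_iff_forall_lt r |>.2 fun y => by
      obtain ⟨n, hn⟩ := exists_nat_gt y
      exact (EReal.coe_lt_coe_iff.2 hn).trans_le (h n le_top)
    rw [hr]
    exact le_top
  · rw [enatToEReal, if_neg htop]
    exact h _ (ENat.natCast_toNat htop).le

/-- For the left shift action of a countable sofic group `G` on `X = Z^G`, one has
`mdim_Σ(X) ≤ mdim_{Σ,M}(X) ≤ dim Z`; if moreover `Z` contains a copy of `[0,1]^n` for every
natural number `n ≤ dim Z`, then `mdim_Σ(X) = mdim_{Σ,M}(X) = dim Z`. -/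
theorem mdimSigma_shift {G : Type*} [Group G] [Countable G] (Sap : SoficApprox G)
    (Z : Type*) [TopologicalSpace Z] [CompactSpace Z] [MetrizableSpace Z] :
    ((∀ ρ : ContPseudoMetric (G → Z), ρ.IsCompatMetric →
        mdimSigma Sap ρ ≤ mdimSigmaMFull Sap (G → Z)) ∧
      mdimSigmaMFull Sap (G → Z) ≤ enatToEReal (covDim Z)) ∧
    ((∀ n : ℕ, (n : ℕ∞) ≤ covDim Z →
        ∃ f : (Fin n → Set.Icc (0 : ℝ) 1) → Z, Continuous f ∧ Function.Injective f) →
      (∀ ρ : ContPseudoMetric (G → Z), ρ.IsCompatMetric →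
        mdimSigma Sap ρ = enatToEReal (covDim Z)) ∧
      mdimSigmaMFull Sap (G → Z) = enatToEReal (covDim Z)) := by
  have hle : ∀ ρ : ContPseudoMetric (G → Z), ρ.IsCompatMetric →
      mdimSigma Sap ρ ≤ mdimSigmaMFull Sap (G → Z) := fun ρ hρ =>
    le_iInf fun ρ' => mdimSigma_le_mdimSigmaM Sap hρ ρ'.2
  have hdim := mdimSigmaMFull_le_covDim Sap Z
  refine ⟨⟨hle, hdim⟩, fun hcube => ?_⟩
  have hge : ∀ ρ : ContPseudoMetric (G → Z), enatToEReal (covDim Z) ≤ mdimSigma Sap ρ :=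
    fun ρ => enatToEReal_le_of_forall fun n hn => by
      obtain ⟨f, hf, hinj⟩ := hcube n hn
      exact le_mdimSigma_of_cube Sap ρ hf hinj
  exact ⟨fun ρ hρ => ((hle ρ hρ).trans hdim).antisymm (hge ρ),
    hdim.antisymm (le_iInf fun ρ => (hge ρ.1).trans (mdimSigma_le_mdimSigmaM Sap ρ.2 ρ.2))⟩

end SoficMD
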